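/- Let K_xy ⊂ ℝ^{n+m} and K_yz ⊂ ℝ^{m+p} be compact, and assume K has nonempty interior. If f ∈ ℝ[X,Y] + ℝ[Y,Z] and f(x,y,z) > 0 for all (x,y,z) ∈ K, then f ∈ P(g) + P(h), i.e. f = σ + ψ for some σ ∈ P(g) and ψ ∈ P(h). -/

import Mathlib

open MvPolynomial

/-- A polynomial is a sum of squares. -/
def IsSOS {ι : Type*} (q : MvPolynomial ι ℝ) : Prop :=
  ∃ (k : ℕ) (s : Fin k → MvPolynomial ι ℝ), q = ∑ i, (s i) ^ 2

/-- Membership in the preordering generated by a finite family `g`: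
`σ = Σ_{J ⊆ I} σ_J ∏_{j ∈ J} g_j` with each `σ_J` a sum of squares. -/
def InPreordering {ι κ : Type*} [Fintype κ] [DecidableEq κ]
    (g : κ → MvPolynomial ι ℝ) (σ : MvPolynomial ι ℝ) : Prop :=
  ∃ c : Finset κ → MvPolynomial ι ℝ,
    (∀ J, IsSOS (c J)) ∧ σ = ∑ J : Finset κ, c J * ∏ j ∈ J, g j

set_option linter.unusedSectionVars false

def IVTField (R : Type) [Field R] [LinearOrder R] : Prop :=
  ∀ (p : Polynomial R) (a b : R), a < b → p.eval a * p.eval b < 0 →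
    ∃ c, a < c ∧ c < b ∧ p.eval c = 0

section Analysis
variable {R : Type} [Field R] [LinearOrder R] [IsStrictOrderedRing R]

theorem ivt_sign (hR : IVTField R) (p : Polynomial R) {a b : R} (hab : a < b)
    (h0 : ∀ c, a < c → c < b → p.eval c ≠ 0) (ha : p.eval a ≠ 0) (hb : p.eval b ≠ 0) :
    SignType.sign (p.eval a) = SignType.sign (p.eval b) := by
  rcases lt_or_gt_of_ne ha with h1 | h1 <;> rcases lt_or_gt_of_ne hb with h2 | h2
  · rw [sign_neg h1, sign_neg h2]
  · obtain ⟨c, h3, h4, h5⟩ := hR p a b hab (mul_neg_of_neg_of_pos h1 h2)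
    exact absurd h5 (h0 c h3 h4)
  · obtain ⟨c, h3, h4, h5⟩ := hR p a b hab (mul_neg_of_pos_of_neg h1 h2)
    exact absurd h5 (h0 c h3 h4)
  · rw [sign_pos h1, sign_pos h2]

theorem rolle_consecutive (hR : IVTField R) (p : Polynomial R) (hp : p ≠ 0) {a b : R} (hab : a < b)
    (ha : p.eval a = 0) (hb : p.eval b = 0) (h0 : ∀ c, a < c → c < b → p.eval c ≠ 0) :
    ∃ c, a < c ∧ c < b ∧ p.derivative.eval c = 0 := by
  obtain ⟨q, hq, hqa⟩ := p.exists_eq_pow_rootMultiplicity_mul_and_not_dvd hp a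
  set m := p.rootMultiplicity a with hm
  have hm1 : 0 < m := (Polynomial.rootMultiplicity_pos hp).2 ha
  have hq0 : q ≠ 0 := by rintro rfl; simp at hqa
  obtain ⟨s, hs, hsb⟩ := q.exists_eq_pow_rootMultiplicity_mul_and_not_dvd hq0 b
  set n := q.rootMultiplicity b with hn
  have hqb : q.eval b = 0 := by
    rw [hq] at hb
    simp only [Polynomial.eval_mul, Polynomial.eval_pow, Polynomial.eval_sub, Polynomial.eval_X,
      Polynomial.eval_C] at hb
    rcases mul_eq_zero.1 hb with h | h
    · exact absurd (pow_eq_zero_iff (by omega) |>.1 h) (by linarith [sub_pos.2 hab] )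
    · exact h
  have hn1 : 0 < n := (Polynomial.rootMultiplicity_pos hq0).2 hqb
  have hsb' : s.eval b ≠ 0 := fun h => hsb (Polynomial.dvd_iff_isRoot.2 h)
  have hsa' : s.eval a ≠ 0 := fun h => hqa (by
    rw [hs]; exact Dvd.dvd.mul_left (Polynomial.dvd_iff_isRoot.2 h) _)
  have hsc : ∀ c, a < c → c < b → s.eval c ≠ 0 := by
    intro c h1 h2 h3
    apply h0 c h1 h2
    rw [hq, hs]; simp [h3]
  have hsign := ivt_sign hR s hab hsc hsa' hsb'
  obtain ⟨m', hm'⟩ : ∃ m', m = m' + 1 := ⟨m - 1, by omega⟩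
  obtain ⟨n', hn'⟩ : ∃ n', n = n' + 1 := ⟨n - 1, by omega⟩
  let A : Polynomial R := Polynomial.X - Polynomial.C a
  let B : Polynomial R := Polynomial.X - Polynomial.C b
  let G : Polynomial R := ((m : Polynomial R) * B + (n : Polynomial R) * A) * s + A * B * s.derivative
  have hG : p.derivative = A ^ m' * B ^ n' * G := by
    rw [hq, hs]
    simp only [Polynomial.derivative_mul, Polynomial.derivative_pow, Polynomial.derivative_sub,
      Polynomial.derivative_X, Polynomial.derivative_C]
    rw [hm', hn']
    simp only [G, A, B, hm', hn', Nat.add_sub_cancel]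
    push_cast
    simp
    ring
  have hGa : G.eval a = m * (a - b) * s.eval a := by simp [G, A, B]
  have hGb : G.eval b = n * (b - a) * s.eval b := by simp [G, A, B]
  have hlt : G.eval a * G.eval b < 0 := by
    rw [hGa, hGb]
    have h1 : 0 < s.eval a * s.eval b := by
      rcases lt_or_gt_of_ne hsa' with h1 | h1 <;> rcases lt_or_gt_of_ne hsb' with h2 | h2
      · exact mul_pos_of_neg_of_neg h1 h2
      · rw [sign_neg h1, sign_pos h2] at hsign; exact absurd hsign (by decide)
      · rw [sign_pos h1, sign_neg h2] at hsign; exact absurd hsign (by decide)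
      · exact mul_pos h1 h2
    have h2 : (0 : R) < m := by exact_mod_cast hm1
    have h3 : (0 : R) < n := by exact_mod_cast hn1
    have h4 : 0 < b - a := sub_pos.2 hab
    have : 0 < (m * n * ((b - a) * (b - a))) * (s.eval a * s.eval b) := by positivity
    nlinarith
  obtain ⟨c, h1, h2, h3⟩ := hR G a b hab hlt
  exact ⟨c, h1, h2, by rw [hG]; simp [h3]⟩

theorem rolle (hR : IVTField R) (p : Polynomial R) {a b : R} (hab : a < b)
    (ha : p.eval a = 0) (hb : p.eval b = 0) :
    ∃ c, a < c ∧ c < b ∧ p.derivative.eval c = 0 := by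
  by_cases hp : p = 0
  · obtain ⟨c, h1, h2⟩ := exists_between hab
    exact ⟨c, h1, h2, by simp [hp]⟩
  · classical
    let T := p.roots.toFinset.filter (fun x => a < x)
    have hbT : b ∈ T := by simp [T, hp, hab, hb]
    have hne : T.Nonempty := ⟨b, hbT⟩
    have hmT := T.min'_mem hne
    set d := T.min' hne with hd
    have hdb : d ≤ b := T.min'_le b hbT
    simp only [T, Finset.mem_filter, Multiset.mem_toFinset, Polynomial.mem_roots hp] at hmT
    obtain ⟨c, h1, h2, h3⟩ := rolle_consecutive hR p hp hmT.2 ha hmT.1 (by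
      intro c h1 h2 h3
      have : d ≤ c := T.min'_le c (by simp [T, hp, h1, h3])
      exact absurd h2 (not_lt.2 this))
    exact ⟨c, h1, h2.trans_le hdb, h3⟩

theorem mvt (hR : IVTField R) (p : Polynomial R) {a b : R} (hab : a < b) :
    ∃ c, a < c ∧ c < b ∧ p.eval b - p.eval a = p.derivative.eval c * (b - a) := by
  obtain ⟨c, h1, h2, h3⟩ := rolle hR (Polynomial.C (b - a) * (p - Polynomial.C (p.eval a)) -
    Polynomial.C (p.eval b - p.eval a) * (Polynomial.X - Polynomial.C a)) hab (by simp) (by simp; ring)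
  refine ⟨c, h1, h2, ?_⟩
  simp at h3
  linarith

theorem eventually_pos_aux (n : ℕ) : ∀ (p : Polynomial R), p.natDegree = n → 0 < p.leadingCoeff →
    ∃ c > 0, ∃ B, ∀ x ≥ B, c ≤ p.eval x := by
  induction n with
  | zero =>
    intro p hp hl
    rw [Polynomial.eq_C_of_natDegree_eq_zero hp] at hl ⊢
    exact ⟨p.coeff 0, by simpa using hl, 0, by simp⟩
  | succ n ih =>
    intro p hp hl
    have h1 : p.divX.natDegree = n := by rw [Polynomial.natDegree_divX_eq_natDegree_tsub_one]; omega
    have h2 : 0 < p.divX.leadingCoeff := by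
      rw [Polynomial.leadingCoeff, h1, Polynomial.coeff_divX, ← hp]; exact hl
    obtain ⟨c, hc, B, hB⟩ := ih _ h1 h2
    refine ⟨1, one_pos, max (max B 0) ((1 + |p.coeff 0|) / c), fun x hx => ?_⟩
    have hx1 : B ≤ x := (le_max_left _ _).trans ((le_max_left _ _).trans hx)
    have hx0 : 0 ≤ x := (le_max_right _ _).trans ((le_max_left _ _).trans hx)
    have hx2 : (1 + |p.coeff 0|) / c ≤ x := (le_max_right _ _).trans hx
    rw [div_le_iff₀ hc] at hx2
    have h3 := hB x hx1
    have h4 : p.eval x = p.divX.eval x * x + p.coeff 0 := by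
      conv_lhs => rw [← p.divX_mul_X_add]
      simp
    rw [h4]
    have h5 := neg_abs_le (p.coeff 0)
    nlinarith

theorem eventually_sign_top (p : Polynomial R) (hp : p ≠ 0) :
    ∃ B, ∀ x ≥ B, SignType.sign (p.eval x) = SignType.sign p.leadingCoeff := by
  rcases lt_or_gt_of_ne (Polynomial.leadingCoeff_ne_zero.2 hp) with h | h
  · obtain ⟨c, hc, B, hB⟩ := eventually_pos_aux _ (-p) rfl (by simpa using h)
    refine ⟨B, fun x hx => ?_⟩
    have := hB x hx
    rw [Polynomial.eval_neg] at this
    rw [sign_neg h, sign_neg (by linarith)]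
  · obtain ⟨c, hc, B, hB⟩ := eventually_pos_aux _ p rfl h
    refine ⟨B, fun x hx => ?_⟩
    have := hB x hx
    rw [sign_pos h, sign_pos (by linarith)]

theorem eventually_sign_bot (p : Polynomial R) (hp : p ≠ 0) :
    ∃ B, ∀ x ≤ B, SignType.sign (p.eval x) =
      SignType.sign ((-1) ^ p.natDegree * p.leadingCoeff) := by
  have hd : (p.comp (-Polynomial.X)).natDegree = p.natDegree := by
    rw [Polynomial.natDegree_comp]; simp
  have hl : (p.comp (-Polynomial.X)).leadingCoeff = (-1) ^ p.natDegree * p.leadingCoeff := by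
    rw [Polynomial.leadingCoeff_comp (by simp)]; simp [mul_comm]
  obtain ⟨B, hB⟩ := eventually_sign_top (p.comp (-Polynomial.X)) (by
    rw [← Polynomial.leadingCoeff_ne_zero, hl]
    exact mul_ne_zero (by simp) (Polynomial.leadingCoeff_ne_zero.2 hp))
  refine ⟨-B, fun x hx => ?_⟩
  have := hB (-x) (by linarith)
  rw [hl] at this
  rw [← this]; simp
end Analysis

section Core
variable {R R' : Type} [Field R] [LinearOrder R] [IsStrictOrderedRing R]
  [Field R'] [LinearOrder R'] [IsStrictOrderedRing R']

def SamePos (Z : Finset (R × R')) (t : R) (t' : R') : Prop :=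
  ∀ z ∈ Z, (z.1 < t ↔ z.2 < t') ∧ (t < z.1 ↔ t' < z.2)

def IsPIso (Z : Finset (R × R')) : Prop := ∀ z ∈ Z, SamePos Z z.1 z.2

theorem samePos_swap (Z : Finset (R × R')) (t : R) (t' : R') (h : SamePos Z t t') :
    SamePos (Z.map (Equiv.prodComm R R').toEmbedding) t' t := by
  intro z hz
  simp only [Finset.mem_map_equiv] at hz
  have := h _ hz
  simp at this
  exact ⟨this.1.symm, this.2.symm⟩

theorem samePos_of_swap (Z : Finset (R × R')) (t : R) (t' : R')
    (h : SamePos (Z.map (Equiv.prodComm R R').toEmbedding) t' t) : SamePos Z t t' := by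
  intro z hz
  have := h z.swap (by simpa [Finset.mem_map_equiv] using hz)
  exact ⟨this.1.symm, this.2.symm⟩

theorem isPIso_swap {Z : Finset (R × R')} (h : IsPIso Z) :
    IsPIso (Z.map (Equiv.prodComm R R').toEmbedding) := by
  intro z hz
  simp only [Finset.mem_map_equiv] at hz
  exact samePos_swap _ _ _ (h _ hz)

theorem cmp_eq_of_iff {a b : R} {c d : R'} (h1 : a < b ↔ c < d) (h2 : b < a ↔ d < c) :
    cmp a b = cmp c d := by
  rcases lt_trichotomy a b with h | h | h
  · rw [(cmp_eq_lt_iff _ _).2 h, (cmp_eq_lt_iff _ _).2 (h1.1 h)]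
  · have : c = d := le_antisymm (not_lt.1 fun hh => by have := h2.2 hh; order)
      (not_lt.1 fun hh => by have := h1.2 hh; order)
    rw [(cmp_eq_eq_iff _ _).2 h, (cmp_eq_eq_iff _ _).2 this]
  · rw [(cmp_eq_gt_iff _ _).2 h, (cmp_eq_gt_iff _ _).2 (h2.1 h)]

theorem exists_samePos {Z : Finset (R × R')} (h : IsPIso Z) (t : R) : ∃ t', SamePos Z t t' := by
  obtain ⟨b, hb⟩ := Order.PartialIso.exists_across (α := R) (β := R') ⟨Z, by
    intro p hp q hq
    exact cmp_eq_of_iff (h q hq p hp).1 (h q hq p hp).2⟩ t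
  refine ⟨b, fun z hz => ?_⟩
  have := hb z hz
  rw [← cmp_eq_lt_iff, ← cmp_eq_lt_iff, ← cmp_eq_gt_iff, ← cmp_eq_gt_iff, this]
  exact ⟨Iff.rfl, Iff.rfl⟩

theorem exists_samePos' {Z : Finset (R × R')} (h : IsPIso Z) (t' : R') : ∃ t, SamePos Z t t' := by
  obtain ⟨t, ht⟩ := exists_samePos (isPIso_swap h) t'
  exact ⟨t, samePos_of_swap _ _ _ ht⟩

theorem exists_gap (F : Finset R) (r : R) (hr : r ∉ F) :
    ∃ l u, l < r ∧ r < u ∧ ∀ x ∈ F, x ≤ l ∨ u ≤ x := by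
  induction F using Finset.induction_on with
  | empty => exact ⟨r - 1, r + 1, by simp, by simp, by simp⟩
  | insert a F ha ih =>
    simp only [Finset.mem_insert, not_or] at hr
    obtain ⟨l, u, h1, h2, h3⟩ := ih hr.2
    rcases lt_or_gt_of_ne hr.1 with h | h
    · refine ⟨l, min u a, h1, lt_min h2 h, fun x hx => ?_⟩
      rcases Finset.mem_insert.1 hx with rfl | hx
      · right; exact min_le_right _ _
      · rcases h3 x hx with h | h
        · exact Or.inl h
        · exact Or.inr ((min_le_left _ _).trans h)
    · refine ⟨max l a, u, max_lt h1 h, h2, fun x hx => ?_⟩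
      rcases Finset.mem_insert.1 hx with rfl | hx
      · left; exact le_max_right _ _
      · rcases h3 x hx with h | h
        · exact Or.inl (h.trans (le_max_left _ _))
        · exact Or.inr h

def Agree (Z : Finset (R × R')) (q : Polynomial R) (q' : Polynomial R') : Prop :=
  ∀ t t', SamePos Z t t' → SignType.sign (q.eval t) = SignType.sign (q'.eval t')

theorem agree_swap {Z : Finset (R × R')} {q : Polynomial R} {q' : Polynomial R'}
    (h : Agree Z q q') : Agree (Z.map (Equiv.prodComm R R').toEmbedding) q' q :=
  fun t t' ht => (h t' t (samePos_of_swap _ _ _ ht)).symm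

theorem root_mem {Z : Finset (R × R')} (hZ : IsPIso Z) {q : Polynomial R} {q' : Polynomial R'}
    (hq : Agree Z q q') (hq0 : q ≠ 0) {r : R} (hr : q.eval r = 0) : ∃ z ∈ Z, z.1 = r := by
  classical
  by_contra hcon
  push Not at hcon
  obtain ⟨l, u, h1, h2, h3⟩ := exists_gap (Z.image Prod.fst) r (by
    simp only [Finset.mem_image, not_exists, not_and]; exact hcon)
  obtain ⟨r', hr'⟩ := exists_samePos hZ r
  have key : ∀ t ∈ Set.Ioo l u, q.eval t = 0 := by
    intro t ht
    have : SamePos Z t r' := by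
      intro z hz
      have h4 := h3 z.1 (Finset.mem_image_of_mem _ hz)
      have h5 := hr' z hz
      rw [← h5.1, ← h5.2]
      obtain ⟨ht1, ht2⟩ := ht
      rcases h4 with h4 | h4
      · exact ⟨⟨fun _ => by order, fun _ => by order⟩, ⟨fun _ => by order, fun _ => by order⟩⟩
      · exact ⟨⟨fun _ => by order, fun _ => by order⟩, ⟨fun _ => by order, fun _ => by order⟩⟩
    have h6 := hq t r' this
    rw [← hq r r' hr', hr, sign_zero, sign_eq_zero_iff] at h6
    exact h6
  have hfin : (Set.Ioo l u).Finite := (q.roots.toFinset.finite_toSet).subset (fun t ht => by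
    simp [hq0, key t ht])
  exact (Set.Ioo_infinite (h1.trans h2)) hfin

theorem root_mem' {Z : Finset (R × R')} (hZ : IsPIso Z) {q : Polynomial R} {q' : Polynomial R'}
    (hq : Agree Z q q') (hq0 : q' ≠ 0) {r : R'} (hr : q'.eval r = 0) : ∃ z ∈ Z, z.2 = r := by
  obtain ⟨z, hz, h⟩ := root_mem (isPIso_swap hZ) (agree_swap hq) hq0 hr
  simp only [Finset.mem_map_equiv] at hz
  exact ⟨_, hz, h⟩

theorem agree_zero {Z : Finset (R × R')} (hZ : IsPIso Z) {q' : Polynomial R'}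
    (hq : Agree Z (0 : Polynomial R) q') : q' = 0 := by
  apply Polynomial.funext
  intro t'
  obtain ⟨t, ht⟩ := exists_samePos' hZ t'
  have := hq t t' ht
  rw [Polynomial.eval_zero, sign_zero, eq_comm, sign_eq_zero_iff] at this
  simpa using this

theorem exists_root_of_sign_ne (hR : IVTField R) (q : Polynomial R) {a b : R} (hab : a < b)
    (h : SignType.sign (q.eval a) ≠ SignType.sign (q.eval b)) :
    ∃ c, a ≤ c ∧ c ≤ b ∧ q.eval c = 0 := by
  by_contra hcon
  push Not at hcon
  exact h (ivt_sign hR q hab (fun c h1 h2 => hcon c h1.le h2.le) (hcon a le_rfl hab.le)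
    (hcon b hab.le le_rfl))

theorem shrink (hR' : IVTField R') {Z : Finset (R × R')} (hZ : IsPIso Z)
    (S : Set (Polynomial R × Polynomial R')) (hS : ∀ q ∈ S, Agree Z q.1 q.2) :
    ∃ Z0 ⊆ Z, IsPIso Z0 ∧ (∀ q ∈ S, Agree Z0 q.1 q.2) ∧
      ∀ z ∈ Z0, ∃ q ∈ S, q.1 ≠ 0 ∧ q.1.eval z.1 = 0 := by
  classical
  refine ⟨Z.filter (fun z => ∃ q ∈ S, q.1 ≠ 0 ∧ q.1.eval z.1 = 0), Finset.filter_subset _ _, ?_, ?_, ?_⟩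
  · intro z hz w hw
    exact hZ z (Finset.mem_filter.1 hz).1 w (Finset.mem_filter.1 hw).1
  · intro q hq t t' ht
    obtain ⟨t'', ht''⟩ := exists_samePos hZ t
    rw [hS q hq t t'' ht'']
    by_contra hne
    have hq0 : q.2 ≠ 0 := by intro h; simp [h] at hne
    have hq1 : q.1 ≠ 0 := fun h => hq0 (agree_zero hZ (by rw [← h]; exact hS q hq))
    have key : ∀ r', q.2.eval r' = 0 →
        (r' < t' ↔ r' < t'') ∧ (t' < r' ↔ t'' < r') := by
      intro r' hr'
      obtain ⟨z, hz, rfl⟩ := root_mem' hZ (hS q hq) hq0 hr'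
      have h1 := hS q hq z.1 z.2 (hZ z hz)
      rw [hr', sign_zero, sign_eq_zero_iff] at h1
      have h2 := ht z (Finset.mem_filter.2 ⟨hz, q, hq, hq1, h1⟩)
      have h3 := ht'' z hz
      exact ⟨h2.1.symm.trans h3.1, h2.2.symm.trans h3.2⟩
    rcases lt_trichotomy t' t'' with h | h | h
    · obtain ⟨c, h1, h2, h3⟩ := exists_root_of_sign_ne hR' q.2 h (Ne.symm hne)
      have := key c h3
      rcases h1.lt_or_eq with h4 | h4
      · have := this.2.1 h4; order
      · have := this.1.2 (by order); order
    · exact hne (by rw [h])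
    · obtain ⟨c, h1, h2, h3⟩ := exists_root_of_sign_ne hR' q.2 h hne
      have := key c h3
      rcases h1.lt_or_eq with h4 | h4
      · have := this.2.2 h4; order
      · have := this.1.1 (by order); order
  · intro z hz
    exact (Finset.mem_filter.1 hz).2

structure CoreData (Z : Finset (R × R')) (p : Polynomial R) (p' : Polynomial R') : Prop where
  iso : IsPIso Z
  der : Agree Z p.derivative p'.derivative
  der0 : p.derivative ≠ 0
  der0' : p'.derivative ≠ 0
  at_z : ∀ z ∈ Z, SignType.sign (p.eval z.1) = SignType.sign (p'.eval z.2)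
  deg : p.natDegree = p'.natDegree
  lc : SignType.sign p.leadingCoeff = SignType.sign p'.leadingCoeff

theorem CoreData.swap {Z : Finset (R × R')} {p : Polynomial R} {p' : Polynomial R'}
    (h : CoreData Z p p') : CoreData (Z.map (Equiv.prodComm R R').toEmbedding) p' p where
  iso := isPIso_swap h.iso
  der := agree_swap h.der
  der0 := h.der0'
  der0' := h.der0
  at_z := by
    intro z hz
    simp only [Finset.mem_map_equiv] at hz
    exact (h.at_z _ hz).symm
  deg := h.deg.symm
  lc := h.lc.symm

theorem CoreData.ne {Z : Finset (R × R')} {p : Polynomial R} {p' : Polynomial R'}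
    (h : CoreData Z p p') : p ≠ 0 := by
  intro h0; exact h.der0 (by simp [h0])

theorem CoreData.bot {Z : Finset (R × R')} {p : Polynomial R} {p' : Polynomial R'}
    (h : CoreData Z p p') (r : R) (r' : R') : ∃ u u', u < r ∧ u' < r' ∧
      (∀ x ≤ u, SignType.sign (p.eval x) = SignType.sign (p.eval u)) ∧
      (∀ x ≤ u', SignType.sign (p'.eval x) = SignType.sign (p'.eval u')) ∧
      SignType.sign (p.eval u) = SignType.sign (p'.eval u') := by
  obtain ⟨B, hB⟩ := eventually_sign_bot p h.ne
  obtain ⟨B', hB'⟩ := eventually_sign_bot p' h.swap.ne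
  refine ⟨min B (r - 1), min B' (r' - 1), ?_, ?_, ?_, ?_, ?_⟩
  · exact (min_le_right _ _).trans_lt (by simp)
  · exact (min_le_right _ _).trans_lt (by simp)
  · intro x hx
    rw [hB x (hx.trans (min_le_left _ _)), hB _ (min_le_left _ _)]
  · intro x hx
    rw [hB' x (hx.trans (min_le_left _ _)), hB' _ (min_le_left _ _)]
  · rw [hB _ (min_le_left _ _), hB' _ (min_le_left _ _), sign_mul, sign_mul, h.lc, h.deg]
    congr 1
    rcases neg_one_pow_eq_or R p'.natDegree with h1 | h1 <;>
    rcases neg_one_pow_eq_or R' p'.natDegree with h2 | h2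
    · rw [h1, h2]; simp
    · rw [neg_one_pow_eq_one_iff_even (by norm_num)] at h1
      rw [h1.neg_one_pow, h1.neg_one_pow]; simp
    · rw [neg_one_pow_eq_one_iff_even (by norm_num)] at h2
      rw [h2.neg_one_pow, h2.neg_one_pow]; simp
    · rw [h1, h2]; simp

theorem CoreData.left {Z : Finset (R × R')} {p : Polynomial R} {p' : Polynomial R'}
    (h : CoreData Z p p') (r : R) (r' : R') (hr : SamePos Z r r') : ∃ u u', u < r ∧ u' < r' ∧
      SignType.sign (p.eval u) = SignType.sign (p'.eval u') ∧
      ∀ z ∈ Z, z.1 < r → z.1 ≤ u ∧ z.2 ≤ u' := by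
  classical
  by_cases hne : (Z.filter (fun z => z.1 < r)).Nonempty
  · obtain ⟨w, hw, hmax⟩ := Finset.exists_max_image _ Prod.fst hne
    rw [Finset.mem_filter] at hw
    refine ⟨w.1, w.2, hw.2, ((hr w hw.1).1).1 hw.2, h.at_z w hw.1, fun z hz hzr => ?_⟩
    have h1 := hmax z (Finset.mem_filter.2 ⟨hz, hzr⟩)
    refine ⟨h1, not_lt.1 fun h2 => ?_⟩
    have := ((h.iso w hw.1 z hz).2).2 h2
    order
  · obtain ⟨u, u', h1, h2, -, -, h3⟩ := h.bot r r'
    refine ⟨u, u', h1, h2, h3, fun z hz hzr => absurd ⟨z, Finset.mem_filter.2 ⟨hz, hzr⟩⟩ hne⟩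

theorem CoreData.right {Z : Finset (R × R')} {p : Polynomial R} {p' : Polynomial R'}
    (h : CoreData Z p p') (r : R) (r' : R') (hr : SamePos Z r r') : ∃ u u', r < u ∧ r' < u' ∧
      SignType.sign (p.eval u) = SignType.sign (p'.eval u') ∧
      ∀ z ∈ Z, r < z.1 → u ≤ z.1 ∧ u' ≤ z.2 := by
  classical
  by_cases hne : (Z.filter (fun z => r < z.1)).Nonempty
  · obtain ⟨w, hw, hmax⟩ := Finset.exists_min_image _ Prod.fst hne
    rw [Finset.mem_filter] at hw
    refine ⟨w.1, w.2, hw.2, ((hr w hw.1).2).1 hw.2, h.at_z w hw.1, fun z hz hzr => ?_⟩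
    have h1 := hmax z (Finset.mem_filter.2 ⟨hz, hzr⟩)
    refine ⟨h1, not_lt.1 fun h2 => ?_⟩
    have := ((h.iso w hw.1 z hz).1).2 h2
    order
  · obtain ⟨B, hB⟩ := eventually_sign_top p h.ne
    obtain ⟨B', hB'⟩ := eventually_sign_top p' h.swap.ne
    refine ⟨max B (r + 1), max B' (r' + 1), ?_, ?_, ?_, ?_⟩
    · exact lt_of_lt_of_le (by simp) (le_max_right _ _)
    · exact lt_of_lt_of_le (by simp) (le_max_right _ _)
    · rw [hB _ (le_max_left _ _), hB' _ (le_max_left _ _), h.lc]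
    · exact fun z hz hzr => absurd ⟨z, Finset.mem_filter.2 ⟨hz, hzr⟩⟩ hne

theorem CoreData.transfer_root (hR : IVTField R) (hR' : IVTField R')
    {Z : Finset (R × R')} {p : Polynomial R} {p' : Polynomial R'}
    (h : CoreData Z p p') (r : R) (hr0 : p.eval r = 0) :
    ∃ r', p'.eval r' = 0 ∧ SamePos Z r r' := by
  obtain ⟨r', hr'⟩ := exists_samePos h.iso r
  by_cases hmem : ∃ z ∈ Z, z.1 = r
  · obtain ⟨z, hz, rfl⟩ := hmem
    refine ⟨z.2, ?_, h.iso z hz⟩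
    have := h.at_z z hz
    rw [hr0, sign_zero, eq_comm, sign_eq_zero_iff] at this
    exact this
  push Not at hmem
  obtain ⟨u, u', hu, hu', hus, huZ⟩ := h.left r r' hr'
  obtain ⟨w, w', hw, hw', hws, hwZ⟩ := h.right r r' hr'
  have pos : ∀ c', u' < c' → c' < w' → SamePos Z r c' := by
    intro c' h1 h2 z hz
    rcases lt_or_gt_of_ne (hmem z hz) with h3 | h3
    · have := huZ z hz h3
      exact ⟨⟨fun _ => by order, fun _ => by order⟩, ⟨fun _ => by order, fun _ => by order⟩⟩
    · have := hwZ z hz h3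
      exact ⟨⟨fun _ => by order, fun _ => by order⟩, ⟨fun _ => by order, fun _ => by order⟩⟩
  have pos' : ∀ c, u < c → c < w → SamePos Z c r' := by
    intro c h1 h2 z hz
    have h0 := hr' z hz
    rcases lt_or_gt_of_ne (hmem z hz) with h3 | h3
    · have h4 := huZ z hz h3
      have h5 := h0.1.1 h3
      exact ⟨⟨fun _ => by order, fun _ => by order⟩, ⟨fun _ => by order, fun _ => by order⟩⟩
    · have h4 := hwZ z hz h3
      have h5 := h0.2.1 h3
      exact ⟨⟨fun _ => by order, fun _ => by order⟩, ⟨fun _ => by order, fun _ => by order⟩⟩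
  have hder : p.derivative.eval r ≠ 0 := by
    intro h0
    obtain ⟨z, hz, h1⟩ := root_mem h.iso h.der h.der0 h0
    exact hmem z hz h1
  have hdc : ∀ c, u < c → c < w →
      SignType.sign (p.derivative.eval c) = SignType.sign (p.derivative.eval r) := by
    intro c h1 h2
    rw [h.der c r' (pos' c h1 h2), h.der r r' hr']
  obtain ⟨c1, hc1, hc1', e1⟩ := mvt hR p hu
  obtain ⟨c2, hc2, hc2', e2⟩ := mvt hR p hw
  have s1 := hdc c1 hc1 (hc1'.trans hw)
  have s2 := hdc c2 (hu.trans hc2) hc2'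
  rw [hr0] at e1 e2
  have hlt : p'.eval u' * p'.eval w' < 0 := by
    rcases lt_or_gt_of_ne hder with hd | hd
    · rw [sign_neg hd, sign_eq_neg_one_iff] at s1 s2
      have a1 : 0 < p.eval u := by nlinarith
      have a2 : p.eval w < 0 := by nlinarith
      rw [sign_pos a1, eq_comm, sign_eq_one_iff] at hus
      rw [sign_neg a2, eq_comm, sign_eq_neg_one_iff] at hws
      exact mul_neg_of_pos_of_neg hus hws
    · rw [sign_pos hd, sign_eq_one_iff] at s1 s2
      have a1 : p.eval u < 0 := by nlinarith
      have a2 : 0 < p.eval w := by nlinarith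
      rw [sign_neg a1, eq_comm, sign_eq_neg_one_iff] at hus
      rw [sign_pos a2, eq_comm, sign_eq_one_iff] at hws
      exact mul_neg_of_neg_of_pos hus hws
  obtain ⟨c, h1, h2, h3⟩ := hR' p' u' w' (hu'.trans hw') hlt
  exact ⟨c, h3, pos c h1 h2⟩

theorem CoreData.between {Z : Finset (R × R')} (hR : IVTField R) {p : Polynomial R}
    {p' : Polynomial R'} (h : CoreData Z p p') {r s : R} {r' s' : R'} (hr : SamePos Z r r')
    (hs : SamePos Z s s') (hr0 : p.eval r = 0) (hs0 : p.eval s = 0) (hrs : r < s) : r' < s' := by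
  obtain ⟨c, h1, h2, h3⟩ := rolle hR p hrs hr0 hs0
  obtain ⟨z, hz, rfl⟩ := root_mem h.iso h.der h.der0 h3
  exact ((hr z hz).2.1 h1).trans ((hs z hz).1.1 h2)

theorem sign_right (hR : IVTField R) (p : Polynomial R) {z t : R} (hzt : z < t)
    (h0 : ∀ c, z < c → c ≤ t → p.eval c ≠ 0)
    (hd0 : ∀ c, z < c → c ≤ t → p.derivative.eval c ≠ 0) :
    SignType.sign (p.eval t) = if p.eval z = 0 then SignType.sign (p.derivative.eval t)
      else SignType.sign (p.eval z) := by
  split_ifs with hz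
  · obtain ⟨c, h1, h2, h3⟩ := mvt hR p hzt
    have : SignType.sign (p.derivative.eval c) = SignType.sign (p.derivative.eval t) :=
      ivt_sign hR _ h2 (fun x hx hx' => hd0 x (h1.trans hx) hx'.le) (hd0 c h1 h2.le)
        (hd0 t hzt le_rfl)
    rw [hz, sub_zero] at h3
    rw [h3, sign_mul, this, sign_pos (sub_pos.2 hzt), mul_one]
  · exact (ivt_sign hR p hzt (fun c h1 h2 => h0 c h1 h2.le) hz (h0 t hzt le_rfl)).symm

theorem sign_left_inf (hR : IVTField R) (p : Polynomial R) {u t : R} (hut : u < t)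
    (hu : ∀ x ≤ u, SignType.sign (p.eval x) = SignType.sign (p.eval u))
    (h0 : ∀ c, c ≤ t → p.eval c ≠ 0) :
    SignType.sign (p.eval t) = SignType.sign (p.eval u) :=
  (ivt_sign hR p hut (fun c _ h2 => h0 c h2.le) (h0 u hut.le) (h0 t le_rfl)).symm

theorem core_step (hR : IVTField R) (hR' : IVTField R')
    {Z : Finset (R × R')} {p : Polynomial R} {p' : Polynomial R'}
    (h : CoreData Z p p') : ∃ Z1, Z ⊆ Z1 ∧ IsPIso Z1 ∧ Agree Z1 p p' := by
  classical
  let N := (p.roots.toFinset ×ˢ p'.roots.toFinset).filter (fun z => SamePos Z z.1 z.2)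
  have hN : ∀ z, z ∈ N ↔ p.eval z.1 = 0 ∧ p'.eval z.2 = 0 ∧ SamePos Z z.1 z.2 := by
    intro z
    simp only [N, Finset.mem_filter, Finset.mem_product, Multiset.mem_toFinset,
      Polynomial.mem_roots h.ne, Polynomial.mem_roots h.swap.ne, Polynomial.IsRoot.def, and_assoc]
  have hiso : IsPIso (Z ∪ N) := by
    intro z hz w hw
    rcases Finset.mem_union.1 hz with hz | hz <;> rcases Finset.mem_union.1 hw with hw | hw
    · exact h.iso z hz w hw
    · have := ((hN w).1 hw).2.2 z hz
      exact ⟨this.2, this.1⟩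
    · exact ((hN z).1 hz).2.2 w hw
    · obtain ⟨a1, a2, a3⟩ := (hN z).1 hz
      obtain ⟨b1, b2, b3⟩ := (hN w).1 hw
      exact ⟨⟨h.between hR b3 a3 b1 a1, h.swap.between hR' (samePos_swap _ _ _ b3)
        (samePos_swap _ _ _ a3) b2 a2⟩, ⟨h.between hR a3 b3 a1 b1,
        h.swap.between hR' (samePos_swap _ _ _ a3) (samePos_swap _ _ _ b3) a2 b2⟩⟩
  refine ⟨Z ∪ N, Finset.subset_union_left, hiso, ?_⟩
  intro t t' ht
  have root1 : ∀ r, p.eval r = 0 → ∃ z ∈ Z ∪ N, z.1 = r ∧ p'.eval z.2 = 0 := by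
    intro r hr
    obtain ⟨r', h1, h2⟩ := h.transfer_root hR hR' r hr
    exact ⟨(r, r'), Finset.mem_union_right _ ((hN _).2 ⟨hr, h1, h2⟩), rfl, h1⟩
  have root2 : ∀ r', p'.eval r' = 0 → ∃ z ∈ Z ∪ N, z.2 = r' ∧ p.eval z.1 = 0 := by
    intro r' hr'
    obtain ⟨r, h1, h2⟩ := h.swap.transfer_root hR' hR r' hr'
    exact ⟨(r, r'), Finset.mem_union_right _ ((hN _).2 ⟨h1, hr', samePos_of_swap _ _ _ h2⟩), rfl, h1⟩
  have droot1 : ∀ r, p.derivative.eval r = 0 → ∃ z ∈ Z ∪ N, z.1 = r := by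
    intro r hr
    obtain ⟨z, hz, h1⟩ := root_mem h.iso h.der h.der0 hr
    exact ⟨z, Finset.mem_union_left _ hz, h1⟩
  have droot2 : ∀ r', p'.derivative.eval r' = 0 → ∃ z ∈ Z ∪ N, z.2 = r' := by
    intro r hr
    obtain ⟨z, hz, h1⟩ := root_mem' h.iso h.der h.der0' hr
    exact ⟨z, Finset.mem_union_left _ hz, h1⟩
  have hatz : ∀ z ∈ Z ∪ N, SignType.sign (p.eval z.1) = SignType.sign (p'.eval z.2) := by
    intro z hz
    rcases Finset.mem_union.1 hz with hz | hz
    · exact h.at_z z hz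
    · obtain ⟨a1, a2, a3⟩ := (hN z).1 hz
      rw [a1, a2, sign_zero, sign_zero]
  have htZ : SamePos Z t t' := fun z hz => ht z (Finset.mem_union_left _ hz)
  by_cases hmem : ∃ z ∈ Z ∪ N, z.1 = t
  · obtain ⟨z, hz, rfl⟩ := hmem
    have h1 := ht z hz
    have : z.2 = t' := by
      simp only [lt_self_iff_false, false_iff, not_lt] at h1
      order
    rw [← this]; exact hatz z hz
  push Not at hmem
  have hmem' : ∀ z ∈ Z ∪ N, z.2 ≠ t' := by
    intro z hz h0
    have h1 := ht z hz
    have := hmem z hz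
    rw [h0] at h1
    simp only [lt_self_iff_false, iff_false, not_lt] at h1
    order
  by_cases hne : ((Z ∪ N).filter (fun z => z.1 < t)).Nonempty
  · obtain ⟨w, hw, hmax⟩ := Finset.exists_max_image _ Prod.fst hne
    rw [Finset.mem_filter] at hw
    have hgap : ∀ z ∈ Z ∪ N, w.1 < z.1 → z.1 ≤ t → False := by
      intro z hz h1 h2
      have := hmax z (Finset.mem_filter.2 ⟨hz, lt_of_le_of_ne h2 (hmem z hz)⟩)
      order
    have hgap' : ∀ z ∈ Z ∪ N, w.2 < z.2 → z.2 ≤ t' → False := by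
      intro z hz h1 h2
      exact hgap z hz ((hiso w hw.1 z hz).2.2 h1) (((ht z hz).1.2 (lt_of_le_of_ne h2 (hmem' z hz))).le)
    have hwt' := (ht w hw.1).1.1 hw.2
    rw [sign_right hR p hw.2, sign_right hR' p' hwt']
    · have h1 := hatz w hw.1
      have h2 : p.eval w.1 = 0 ↔ p'.eval w.2 = 0 := by
        rw [← sign_eq_zero_iff, h1, sign_eq_zero_iff]
      rw [h1, h.der t t' htZ]
      simp only [h2]
    · intro c h1 h2 h3
      obtain ⟨z, hz, rfl, -⟩ := root2 c h3
      exact hgap' z hz h1 h2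
    · intro c h1 h2 h3
      obtain ⟨z, hz, rfl⟩ := droot2 c h3
      exact hgap' z hz h1 h2
    · intro c h1 h2 h3
      obtain ⟨z, hz, rfl, -⟩ := root1 c h3
      exact hgap z hz h1 h2
    · intro c h1 h2 h3
      obtain ⟨z, hz, rfl⟩ := droot1 c h3
      exact hgap z hz h1 h2
  · obtain ⟨u, u', h1, h2, h3, h4, h5⟩ := h.bot t t'
    have hno : ∀ z ∈ Z ∪ N, z.1 ≤ t → False := by
      intro z hz hle
      exact hne ⟨z, Finset.mem_filter.2 ⟨hz, lt_of_le_of_ne hle (hmem z hz)⟩⟩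
    rw [sign_left_inf hR p h1 h3, sign_left_inf hR' p' h2 h4, h5]
    · intro c hc h6
      obtain ⟨z, hz, rfl, -⟩ := root2 c h6
      exact hno z hz (((ht z hz).1.2 (lt_of_le_of_ne hc (hmem' z hz))).le)
    · intro c hc h6
      obtain ⟨z, hz, rfl, -⟩ := root1 c h6
      exact hno z hz hc

theorem agree_mono {Z Z1 : Finset (R × R')} (h : Z ⊆ Z1) {q : Polynomial R} {q' : Polynomial R'}
    (hq : Agree Z q q') : Agree Z1 q q' := fun t t' ht => hq t t' (fun z hz => ht z (h hz))

end Core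

section QE
variable {A : Type} [CommRing A]

theorem pseudo_rem (q : Polynomial A) (j : ℕ) (hq : ∀ i, j < i → q.coeff i = 0) (n : ℕ) :
    ∀ p : Polynomial A, (∀ m, n ≤ m → p.coeff m = 0) →
    ∃ (k : ℕ) (a r : Polynomial A), Polynomial.C (q.coeff j) ^ k * p = a * q + r ∧
      ∀ m, j ≤ m → r.coeff m = 0 := by
  induction n with
  | zero =>
    intro p hp
    have : p = 0 := by ext m; simp [hp m]
    exact ⟨0, 0, 0, by simp [this], by simp⟩
  | succ n ih =>
    intro p hp
    by_cases hnj : n < j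
    · exact ⟨0, 0, p, by simp, fun m hm => hp m (by omega)⟩
    · push Not at hnj
      obtain ⟨k, a, r, h1, h2⟩ := ih (Polynomial.C (q.coeff j) * p -
        Polynomial.C (p.coeff n) * Polynomial.X ^ (n - j) * q) (by
          intro m hm
          rw [Polynomial.coeff_sub, mul_assoc, Polynomial.coeff_C_mul, Polynomial.coeff_C_mul,
            Polynomial.coeff_X_pow_mul']
          rw [if_pos (by omega)]
          rcases hm.lt_or_eq with h | h
          · rw [hp m (by omega), hq (m - (n - j)) (by omega)]; simp
          · subst h
            rw [Nat.sub_sub_self hnj]; ring)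
      refine ⟨k + 1, a + Polynomial.C (q.coeff j) ^ k * (Polynomial.C (p.coeff n) *
        Polynomial.X ^ (n - j)), r, ?_, h2⟩
      have : Polynomial.C (q.coeff j) ^ (k + 1) * p = Polynomial.C (q.coeff j) ^ k *
        (Polynomial.C (q.coeff j) * p - Polynomial.C (p.coeff n) * Polynomial.X ^ (n - j) * q) +
        Polynomial.C (q.coeff j) ^ k * (Polynomial.C (p.coeff n) * Polynomial.X ^ (n - j)) * q := by
        ring
      rw [this, h1]; ring

noncomputable def ptrunc (q : Polynomial A) (j : ℕ) : Polynomial A :=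
  ∑ i ∈ Finset.range (j + 1), Polynomial.monomial i (q.coeff i)

theorem ptrunc_coeff (q : Polynomial A) (j i : ℕ) :
    (ptrunc q j).coeff i = if i ≤ j then q.coeff i else 0 := by
  simp [ptrunc, Polynomial.finsetSum_coeff, Polynomial.coeff_monomial, Nat.lt_succ_iff]

theorem exists_prem (p q : Polynomial A) (j : ℕ) : ∃ r : Polynomial A,
    (∃ (k : ℕ) (a : Polynomial A), Polynomial.C (q.coeff j) ^ k * p = a * ptrunc q j + r) ∧
      ∀ m, j ≤ m → r.coeff m = 0 := by
  obtain ⟨k, a, r, h1, h2⟩ := pseudo_rem (ptrunc q j) j (fun i hi => by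
    rw [ptrunc_coeff, if_neg (by omega)]) (p.natDegree + 1) p (fun m hm =>
      Polynomial.coeff_eq_zero_of_natDegree_lt (by omega))
  refine ⟨r, ⟨k, a, ?_⟩, h2⟩
  rw [← h1, ptrunc_coeff, if_pos le_rfl]

noncomputable def prem (p q : Polynomial A) (j : ℕ) : Polynomial A := (exists_prem p q j).choose

theorem prem_spec (p q : Polynomial A) (j : ℕ) :
    ∃ (k : ℕ) (a : Polynomial A), Polynomial.C (q.coeff j) ^ k * p = a * ptrunc q j + prem p q j :=
  (exists_prem p q j).choose_spec.1

theorem prem_natDegree (p q : Polynomial A) (j d : ℕ) (hd : 0 < d) (hj : j ≤ d) :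
    (prem p q j).natDegree < d := by
  have h := (exists_prem p q j).choose_spec.2
  change ∀ m, j ≤ m → (prem p q j).coeff m = 0 at h
  by_contra hc
  push Not at hc
  have h1 := h _ (hj.trans hc)
  rw [Polynomial.coeff_natDegree, Polynomial.leadingCoeff_eq_zero] at h1
  rw [h1, Polynomial.natDegree_zero] at hc
  omega

variable {R R' : Type} [Field R] [LinearOrder R] [IsStrictOrderedRing R]
  [Field R'] [LinearOrder R'] [IsStrictOrderedRing R']

def PMatch (α : A →+* R) (β : A →+* R') (S : Finset (Polynomial A)) : Prop :=
  ∃ Z : Finset (R × R'), IsPIso Z ∧ ∀ q ∈ S, Agree Z (q.map α) (q.map β)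

variable (R R') in
def QElim (S : Finset (Polynomial A)) : Prop :=
  ∃ S' : Finset A, ∀ (α : A →+* R) (β : A →+* R'),
    (∀ c ∈ S', SignType.sign (α c) = SignType.sign (β c)) → PMatch α β S

theorem sign_mul_cancel {x y : R} {x' y' : R'} (hx : x ≠ 0)
    (h : SignType.sign x = SignType.sign x')
    (h2 : SignType.sign (x * y) = SignType.sign (x' * y')) :
    SignType.sign y = SignType.sign y' := by
  rw [sign_mul, sign_mul, ← h] at h2
  have : SignType.sign x ≠ 0 := by rwa [Ne, sign_eq_zero_iff]
  revert this h2
  generalize SignType.sign x = a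
  generalize SignType.sign y = b
  generalize SignType.sign y' = c
  revert a b c
  decide

theorem prem_sign (α : A →+* R) (β : A →+* R') (p q : Polynomial A)
    (hco : ∀ i, SignType.sign (α (q.coeff i)) = SignType.sign (β (q.coeff i)))
    (hq0 : q.map α ≠ 0) (z : R) (z' : R') (hz : (q.map α).eval z = 0)
    (hz' : (q.map β).eval z' = 0)
    (hr : ∀ j ≤ q.natDegree, SignType.sign (((prem p q j).map α).eval z) =
      SignType.sign (((prem p q j).map β).eval z')) :
    SignType.sign ((p.map α).eval z) = SignType.sign ((p.map β).eval z') := by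
  set j := (q.map α).natDegree with hj
  have hjq : j ≤ q.natDegree := Polynomial.natDegree_map_le
  have hc : α (q.coeff j) ≠ 0 := by
    rw [← Polynomial.coeff_map]; exact Polynomial.leadingCoeff_ne_zero.2 hq0
  have hzero : ∀ i, j < i → α (q.coeff i) = 0 := by
    intro i hi
    rw [← Polynomial.coeff_map]; exact Polynomial.coeff_eq_zero_of_natDegree_lt hi
  have e1 : (ptrunc q j).map α = q.map α := by
    ext i
    rw [Polynomial.coeff_map, ptrunc_coeff, Polynomial.coeff_map]
    split_ifs with h
    · rfl
    · rw [hzero i (by omega), map_zero]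
  have e2 : (ptrunc q j).map β = q.map β := by
    ext i
    rw [Polynomial.coeff_map, ptrunc_coeff, Polynomial.coeff_map]
    split_ifs with h
    · rfl
    · have := hco i
      rw [hzero i (by omega), sign_zero, eq_comm, sign_eq_zero_iff] at this
      rw [this, map_zero]
  obtain ⟨k, a, h⟩ := prem_spec p q j
  have h1 := congrArg (fun f => (f.map α).eval z) h
  have h2 := congrArg (fun f => (f.map β).eval z') h
  simp only [Polynomial.map_mul, Polynomial.map_add, Polynomial.map_pow, Polynomial.map_C,
    Polynomial.eval_mul, Polynomial.eval_add, Polynomial.eval_pow, Polynomial.eval_C, e1, e2, hz,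
    hz', mul_zero, zero_add] at h1 h2
  refine sign_mul_cancel (x := α (q.coeff j) ^ k) (x' := β (q.coeff j) ^ k)
    (pow_ne_zero _ hc) ?_ ?_
  · rw [sign_pow, sign_pow, hco j]
  · rw [h1, h2]; exact hr j hjq

theorem qelim_step (hR : IVTField R) (hR' : IVTField R') (d : ℕ)
    (ih : ∀ S : Finset (Polynomial A), (∀ q ∈ S, q.natDegree < d) → QElim R R' S)
    (L : Finset (Polynomial A)) :
    ∀ S : Finset (Polynomial A), (∀ q ∈ L, q.natDegree ≤ d) → (∀ q ∈ S, q.natDegree < d) →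
    ∃ S' : Finset A, ∀ (α : A →+* R) (β : A →+* R'),
    (∀ c ∈ S', SignType.sign (α c) = SignType.sign (β c)) →
      ∃ Z : Finset (R × R'), IsPIso Z ∧ (∀ q ∈ L, Agree Z (q.map α) (q.map β)) ∧
        ∀ q ∈ S, Agree Z (q.map α) (q.map β) := by
  classical
  induction L using Finset.induction_on with
  | empty =>
    intro S _ hS
    obtain ⟨S', h⟩ := ih S hS
    refine ⟨S', fun α β hc => ?_⟩
    obtain ⟨Z, h1, h2⟩ := h α β hc
    exact ⟨Z, h1, by simp, h2⟩
  | insert p L hpL ihL =>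
    intro S hL hS
    have hL' : ∀ q ∈ L, q.natDegree ≤ d := fun q hq => hL q (Finset.mem_insert_of_mem hq)
    have hpd := hL p (Finset.mem_insert_self _ _)
    rcases hpd.lt_or_eq with hpd | hpd
    · obtain ⟨S', h⟩ := ihL (insert p S) hL' (by
        intro q hq; rcases Finset.mem_insert.1 hq with rfl | hq
        exacts [hpd, hS q hq])
      refine ⟨S', fun α β hc => ?_⟩
      obtain ⟨Z, h1, h2, h3⟩ := h α β hc
      refine ⟨Z, h1, ?_, fun q hq => h3 q (Finset.mem_insert_of_mem hq)⟩
      intro q hq; rcases Finset.mem_insert.1 hq with rfl | hq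
      exacts [h3 _ (Finset.mem_insert_self _ _), h2 q hq]
    rcases Nat.eq_zero_or_pos d with hd | hd
    · obtain ⟨S', h⟩ := ihL S hL' hS
      refine ⟨insert (p.coeff 0) S', fun α β hc => ?_⟩
      obtain ⟨Z, h1, h2, h3⟩ := h α β (fun c hc' => hc c (Finset.mem_insert_of_mem hc'))
      refine ⟨Z, h1, ?_, h3⟩
      intro q hq; rcases Finset.mem_insert.1 hq with rfl | hq
      · intro t t' _
        rw [Polynomial.eq_C_of_natDegree_eq_zero (hpd.trans hd)]
        simpa using hc _ (Finset.mem_insert_self _ _)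
      · exact h2 q hq
    obtain ⟨S1', hS1⟩ := ihL (insert p.eraseLead S) hL' (by
        intro q hq; rcases Finset.mem_insert.1 hq with rfl | hq
        · have := Polynomial.eraseLead_natDegree_le p; omega
        · exact hS q hq)
    let D := insert p.derivative (L ∪ S)
    let PR := (D ×ˢ Finset.range (d + 1)).image (fun x => prem p x.1 x.2)
    obtain ⟨S2', hS2⟩ := ihL (insert p.derivative S ∪ PR) hL' (by
        intro q hq
        rcases Finset.mem_union.1 hq with hq | hq
        · rcases Finset.mem_insert.1 hq with rfl | hq
          · rw [← hpd]; exact Polynomial.natDegree_derivative_lt (by omega)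
          · exact hS q hq
        · obtain ⟨x, hx, rfl⟩ := Finset.mem_image.1 hq
          simp only [Finset.mem_product, Finset.mem_range] at hx
          exact prem_natDegree _ _ _ _ hd (by omega))
    let CO := (D ×ˢ Finset.range (d + 1)).image (fun x => x.1.coeff x.2)
    refine ⟨insert p.leadingCoeff (S1' ∪ S2' ∪ CO), fun α β hc => ?_⟩
    have hlc := hc p.leadingCoeff (Finset.mem_insert_self _ _)
    have hc1 : ∀ c ∈ S1', SignType.sign (α c) = SignType.sign (β c) := fun c h => hc c (by simp [h])
    have hc2 : ∀ c ∈ S2', SignType.sign (α c) = SignType.sign (β c) := fun c h => hc c (by simp [h])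
    have hDd : ∀ q ∈ D, q.natDegree ≤ d := by
      intro q hq
      rcases Finset.mem_insert.1 hq with rfl | hq
      · have := Polynomial.natDegree_derivative_le p; omega
      · rcases Finset.mem_union.1 hq with hq | hq
        exacts [hL' q hq, (hS q hq).le]
    have hcD : ∀ q ∈ D, ∀ i, SignType.sign (α (q.coeff i)) = SignType.sign (β (q.coeff i)) := by
      intro q hq i
      by_cases hi : i ≤ d
      · apply hc
        apply Finset.mem_insert_of_mem
        apply Finset.mem_union_right
        exact Finset.mem_image.2 ⟨(q, i), by simp [hq]; omega, rfl⟩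
      · rw [Polynomial.coeff_eq_zero_of_natDegree_lt (lt_of_le_of_lt (hDd q hq) (by omega))]
        simp
    by_cases hl : α p.leadingCoeff = 0
    · have hl' : β p.leadingCoeff = 0 := by
        rw [hl, sign_zero, eq_comm, sign_eq_zero_iff] at hlc; exact hlc
      obtain ⟨Z, h1, h2, h3⟩ := hS1 α β hc1
      refine ⟨Z, h1, ?_, fun q hq => h3 q (Finset.mem_insert_of_mem hq)⟩
      intro q hq; rcases Finset.mem_insert.1 hq with rfl | hq
      · have e1 : q.map α = q.eraseLead.map α := by
          have := congrArg (Polynomial.map α) q.eraseLead_add_C_mul_X_pow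
          rw [Polynomial.map_add, Polynomial.map_mul, Polynomial.map_C, hl] at this
          simpa using this.symm
        have e2 : q.map β = q.eraseLead.map β := by
          have := congrArg (Polynomial.map β) q.eraseLead_add_C_mul_X_pow
          rw [Polynomial.map_add, Polynomial.map_mul, Polynomial.map_C, hl'] at this
          simpa using this.symm
        rw [e1, e2]
        exact h3 _ (Finset.mem_insert_self _ _)
      · exact h2 q hq
    · have hl' : β p.leadingCoeff ≠ 0 := by
        intro h; rw [h, sign_zero, sign_eq_zero_iff] at hlc; exact hl hlc
      obtain ⟨Z, h1, h2, h3⟩ := hS2 α β hc2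
      have hZD : ∀ q ∈ D, Agree Z (q.map α) (q.map β) := by
        intro q hq
        rcases Finset.mem_insert.1 hq with rfl | hq
        · exact h3 _ (by simp)
        · rcases Finset.mem_union.1 hq with hq | hq
          exacts [h2 q hq, h3 q (by simp [hq])]
      obtain ⟨Z0, hsub, hiso, hag, hroot⟩ := shrink hR' h1
        {x | ∃ q ∈ D, x = (q.map α, q.map β)} (by
          rintro x ⟨q, hq, rfl⟩; exact hZD q hq)
      have hag' : ∀ q ∈ D, Agree Z0 (q.map α) (q.map β) := fun q hq => hag _ ⟨q, hq, rfl⟩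
      have hdeg : (p.map α).natDegree = d := by
        rw [Polynomial.natDegree_map_of_leadingCoeff_ne_zero _ hl, hpd]
      have hdeg' : (p.map β).natDegree = d := by
        rw [Polynomial.natDegree_map_of_leadingCoeff_ne_zero _ hl', hpd]
      have core : CoreData Z0 (p.map α) (p.map β) := by
        refine ⟨hiso, ?_, ?_, ?_, ?_, by rw [hdeg, hdeg'], ?_⟩
        · rw [Polynomial.derivative_map, Polynomial.derivative_map]
          exact hag' _ (Finset.mem_insert_self _ _)
        · intro h
          have := Polynomial.natDegree_eq_zero_of_derivative_eq_zero h
          omega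
        · intro h
          have := Polynomial.natDegree_eq_zero_of_derivative_eq_zero h
          omega
        · intro z hz
          obtain ⟨x, ⟨q, hq, rfl⟩, hq0, hqz⟩ := hroot z hz
          have hqz' := hag' q hq z.1 z.2 (hiso z hz)
          simp only at hqz hq0
          rw [hqz, sign_zero, eq_comm, sign_eq_zero_iff] at hqz'
          refine prem_sign α β p q (hcD q hq) hq0 z.1 z.2 hqz hqz' (fun j hj => ?_)
          refine h3 _ ?_ z.1 z.2 (h1 z (hsub hz))
          apply Finset.mem_union_right
          have := hDd q hq
          exact Finset.mem_image.2 ⟨(q, j), by simp [hq]; omega, rfl⟩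
        · rw [Polynomial.leadingCoeff_map_of_leadingCoeff_ne_zero _ hl,
            Polynomial.leadingCoeff_map_of_leadingCoeff_ne_zero _ hl']
          exact hlc
      obtain ⟨Z1, hs1, hi1, ha1⟩ := core_step hR hR' core
      refine ⟨Z1, hi1, ?_, ?_⟩
      · intro q hq; rcases Finset.mem_insert.1 hq with rfl | hq
        · exact ha1
        · exact agree_mono hs1 (hag' q (by simp [D, hq]))
      · intro q hq
        exact agree_mono hs1 (hag' q (by simp [D, hq]))

theorem qelim (hR : IVTField R) (hR' : IVTField R') (S : Finset (Polynomial A)) :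
    QElim R R' S := by
  have key : ∀ d : ℕ, ∀ S : Finset (Polynomial A), (∀ q ∈ S, q.natDegree < d) → QElim R R' S := by
    intro d
    induction d with
    | zero =>
      intro S hS
      refine ⟨∅, fun α β _ => ⟨∅, by intro z hz; simp at hz, fun q hq => ?_⟩⟩
      exact absurd (hS q hq) (by omega)
    | succ d ih =>
      intro S hS
      obtain ⟨S', h⟩ := qelim_step hR hR' d ih S ∅ (fun q hq => Nat.lt_succ_iff.1 (hS q hq)) (by simp)
      refine ⟨S', fun α β hc => ?_⟩
      obtain ⟨Z, h1, h2, -⟩ := h α β hc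
      exact ⟨Z, h1, h2⟩
  exact key (S.sup Polynomial.natDegree + 1) S (fun q hq =>
    Nat.lt_succ_iff.2 (Finset.le_sup (f := Polynomial.natDegree) hq))

theorem transfer_fin (hR : IVTField R) (hR' : IVTField R') {k : Type} [Field k]
    (i : k →+* R) (i' : k →+* R') (hi : ∀ c, SignType.sign (i c) = SignType.sign (i' c)) (n : ℕ) :
    ∀ (S : Finset (MvPolynomial (Fin n) k)) (b : Fin n → R), ∃ a : Fin n → R',
      ∀ p ∈ S, SignType.sign (eval₂ i b p) = SignType.sign (eval₂ i' a p) := by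
  classical
  induction n with
  | zero =>
    intro S b
    refine ⟨finZeroElim, fun p _ => ?_⟩
    obtain ⟨c, rfl⟩ := MvPolynomial.C_surjective (R := k) (Fin 0) p
    simpa using hi c
  | succ n ih =>
    intro S b
    obtain ⟨S', h⟩ := qelim (A := MvPolynomial (Fin n) k) hR hR' (S.image (finSuccEquiv k n))
    obtain ⟨a, ha⟩ := ih S' (Fin.tail b)
    obtain ⟨Z, h1, h2⟩ := h (eval₂Hom i (Fin.tail b)) (eval₂Hom i' a) ha
    obtain ⟨t', ht'⟩ := exists_samePos h1 (b 0)
    have gen : ∀ {F : Type} [Field F] (φ : k →+* F) (t : F) (y : Fin n → F)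
        (p : MvPolynomial (Fin (n + 1)) k),
        ((finSuccEquiv k n p).map (eval₂Hom φ y)).eval t = eval₂ φ (Fin.cons t y) p := by
      intro F _ φ t y p
      induction p using MvPolynomial.induction_on with
      | C c => simp [finSuccEquiv_apply]
      | add p q hp hq => simp [hp, hq]
      | mul_X p j hp =>
        rw [map_mul, Polynomial.map_mul, Polynomial.eval_mul, hp, eval₂_mul, eval₂_X]
        congr 1
        refine Fin.cases ?_ (fun j => ?_) j
        · simp [finSuccEquiv_X_zero]
        · simp [finSuccEquiv_X_succ]
    refine ⟨Fin.cons t' a, fun p hp => ?_⟩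
    have := h2 _ (Finset.mem_image_of_mem _ hp) (b 0) t' ht'
    rw [gen, gen, Fin.cons_self_tail] at this
    exact this
end QE

theorem ivt_real : IVTField ℝ := by
  intro p a b hab h
  have hc : ContinuousOn (fun x => p.eval x) (Set.Icc a b) := p.continuous.continuousOn
  rcases mul_neg_iff.1 h with ⟨h1, h2⟩ | ⟨h1, h2⟩
  · obtain ⟨c, hc1, hc2⟩ := intermediate_value_Ioo' hab.le hc ⟨h2, h1⟩
    exact ⟨c, hc1.1, hc1.2, hc2⟩
  · obtain ⟨c, hc1, hc2⟩ := intermediate_value_Ioo hab.le hc ⟨h1, h2⟩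
    exact ⟨c, hc1.1, hc1.2, hc2⟩

theorem transfer_real {R : Type} [Field R] [LinearOrder R] [IsStrictOrderedRing R]
    (hR : IVTField R) {ι : Type} [Fintype ι] (φ : MvPolynomial ι ℝ →+* R)
    (S : Finset (MvPolynomial ι ℝ)) (hS : ∀ p ∈ S, 0 ≤ φ p) :
    ∃ a : ι → ℝ, ∀ p ∈ S, 0 ≤ eval a p := by
  classical
  let i : ℝ →+* R := φ.comp C
  have hpos : ∀ c : ℝ, 0 < c → 0 < i c := by
    intro c hc
    have h1 : i c = i (Real.sqrt c) * i (Real.sqrt c) := by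
      rw [← map_mul, Real.mul_self_sqrt hc.le]
    have h2 : i c ≠ 0 := by
      rw [Ne, map_eq_zero]; exact hc.ne'
    exact lt_of_le_of_ne (by rw [h1]; exact mul_self_nonneg _) h2.symm
  have hi : ∀ c : ℝ, SignType.sign (i c) = SignType.sign ((RingHom.id ℝ) c) := by
    intro c
    rcases lt_trichotomy c 0 with h | h | h
    · have := hpos (-c) (by linarith)
      rw [map_neg] at this
      rw [RingHom.id_apply, sign_neg h, sign_neg (by linarith)]
    · simp [h]
    · rw [RingHom.id_apply, sign_pos h, sign_pos (hpos c h)]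
  let e := Fintype.equivFin ι
  obtain ⟨a, ha⟩ := transfer_fin hR ivt_real i (RingHom.id ℝ) hi (Fintype.card ι)
    (S.image (rename e)) (fun j => φ (X (e.symm j)))
  refine ⟨a ∘ e, fun p hp => ?_⟩
  have h1 := ha _ (Finset.mem_image_of_mem _ hp)
  rw [eval₂_rename, eval₂_rename] at h1
  have h2 : eval₂ i ((fun j => φ (X (e.symm j))) ∘ e) p = φ p := by
    have : φ = eval₂Hom i ((fun j => φ (X (e.symm j))) ∘ e) := by
      apply MvPolynomial.ringHom_ext
      · intro r; simp [i]
      · intro j; simp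
    conv_rhs => rw [this]
    rfl
  rw [h2] at h1
  have h3 : eval₂ (RingHom.id ℝ) (a ∘ e) p = eval (a ∘ e) p := rfl
  rw [h3] at h1
  have h4 := hS p hp
  by_contra hneg
  push Not at hneg
  rw [sign_neg hneg, sign_eq_neg_one_iff] at h1
  order

section RC

def sqMon (E : Type) [Field E] [LinearOrder E] [IsStrictOrderedRing E] :
    Submonoid (Polynomial E) where
  carrier := {q | ∃ (c : E) (f : Polynomial E), 0 ≤ c ∧ q = Polynomial.C c * f ^ 2}
  one_mem' := ⟨1, 1, zero_le_one, by simp⟩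
  mul_mem' := by
    rintro _ _ ⟨c, f, hc, rfl⟩ ⟨d, g, hd, rfl⟩
    exact ⟨c * d, f * g, mul_nonneg hc hd, by rw [Polynomial.C_mul]; ring⟩

noncomputable def sosT (E : Type) [Field E] [LinearOrder E] [IsStrictOrderedRing E] :
    Subsemiring (Polynomial E) := (sqMon E).subsemiringClosure

theorem sosT_induction {E : Type} [Field E] [LinearOrder E] [IsStrictOrderedRing E]
    {C : Polynomial E → Prop}
    (h0 : C 0) (hadd : ∀ p q, C p → C q → C (p + q))
    (hm : ∀ (c : E) (f : Polynomial E), 0 ≤ c → C (Polynomial.C c * f ^ 2))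
    {s : Polynomial E} (hs : s ∈ sosT E) : C s := by
  have hs' : s ∈ AddSubmonoid.closure (sqMon E : Set (Polynomial E)) := hs
  induction hs' using AddSubmonoid.closure_induction with
  | mem x hx => obtain ⟨c, f, hc, rfl⟩ := hx; exact hm c f hc
  | zero => exact h0
  | add x y _ _ hx hy => exact hadd x y (hx ‹_›) (hy ‹_›)

theorem sosT_mem {E : Type} [Field E] [LinearOrder E] [IsStrictOrderedRing E]
    (c : E) (f : Polynomial E) (hc : 0 ≤ c) : Polynomial.C c * f ^ 2 ∈ sosT E :=
  AddSubmonoid.subset_closure ⟨c, f, hc, rfl⟩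

theorem sosT_eval {E : Type} [Field E] [LinearOrder E] [IsStrictOrderedRing E]
    {s : Polynomial E} (hs : s ∈ sosT E) (a : E) : 0 ≤ s.eval a := by
  refine sosT_induction (C := fun s => 0 ≤ s.eval a) (by simp) ?_ ?_ hs
  · intro p q hp hq; simpa using add_nonneg hp hq
  · intro c f hc; simp; positivity

theorem sosT_reduce {E : Type} [Field E] [LinearOrder E] [IsStrictOrderedRing E]
    (p : Polynomial E) (hp : 0 < p.natDegree)
    {s : Polynomial E} (hs : s ∈ sosT E) : ∃ s' ∈ sosT E, p ∣ s - s' ∧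
      s'.natDegree ≤ 2 * (p.natDegree - 1) := by
  refine sosT_induction (C := fun s => ∃ s' ∈ sosT E, p ∣ s - s' ∧
      s'.natDegree ≤ 2 * (p.natDegree - 1)) ?_ ?_ ?_ hs
  · exact ⟨0, zero_mem _, by simp, by simp⟩
  · rintro s t ⟨s', h1, h2, h3⟩ ⟨t', h4, h5, h6⟩
    refine ⟨s' + t', add_mem h1 h4, ?_, (Polynomial.natDegree_add_le _ _).trans (max_le h3 h6)⟩
    have := dvd_add h2 h5
    convert this using 1; ring
  · intro c f hc
    refine ⟨Polynomial.C c * (f % p) ^ 2, sosT_mem _ _ hc, ?_, ?_⟩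
    · have h1 : p ∣ f - f % p := ⟨f / p, by
        have := EuclideanDomain.div_add_mod f p
        linear_combination -this⟩
      have : Polynomial.C c * f ^ 2 - Polynomial.C c * (f % p) ^ 2 =
        (f - f % p) * (Polynomial.C c * (f + f % p)) := by ring
      rw [this]; exact dvd_mul_of_dvd_left h1 _
    · refine (Polynomial.natDegree_C_mul_le _ _).trans ?_
      refine Polynomial.natDegree_pow_le.trans ?_
      have := Polynomial.natDegree_mod_lt f hp.ne'
      exact Nat.mul_le_mul_left 2 (by omega)

theorem natDegree_pos_of_sign {E : Type} [Field E] [LinearOrder E] [IsStrictOrderedRing E]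
    {p : Polynomial E} {a b : E} (h : p.eval a * p.eval b < 0) : 0 < p.natDegree := by
  by_contra h0
  have h1 : p.natDegree = 0 := by omega
  rw [Polynomial.eq_C_of_natDegree_eq_zero h1] at h
  simp only [Polynomial.eval_C] at h
  exact absurd h (not_lt.2 (mul_self_nonneg _))

theorem no_dvd_of_sign {E : Type} [Field E] [LinearOrder E] [IsStrictOrderedRing E] (a b : E)
    (N : ℕ) : ∀ p : Polynomial E, p.natDegree < N → p.eval a * p.eval b < 0 →
      ∀ s ∈ sosT E, ¬ p ∣ 1 + s := by
  induction N with
  | zero => intro p hp; omega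
  | succ N ih =>
    intro p hpN hp s hs hdvd
    have hd := natDegree_pos_of_sign hp
    obtain ⟨s', h1, h2, h3⟩ := sosT_reduce p hd hs
    have hdvd' : p ∣ 1 + s' := by
      have := dvd_sub hdvd h2
      convert this using 1; ring
    obtain ⟨h, hh⟩ := hdvd'
    have ea : 0 < p.eval a * h.eval a := by
      rw [← Polynomial.eval_mul, ← hh]
      have := sosT_eval h1 a
      simp; linarith
    have eb : 0 < p.eval b * h.eval b := by
      rw [← Polynomial.eval_mul, ← hh]
      have := sosT_eval h1 b
      simp; linarith
    have hab : h.eval a * h.eval b < 0 := by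
      by_contra hc
      push Not at hc
      nlinarith [mul_pos ea eb]
    have hp0 : p ≠ 0 := by rintro rfl; simp at hd
    have hh0 : h ≠ 0 := by rintro rfl; simp at hab
    have hdeg := congrArg Polynomial.natDegree hh
    rw [Polynomial.natDegree_mul hp0 hh0] at hdeg
    have hle : (1 + s').natDegree ≤ 2 * (p.natDegree - 1) := by
      refine (Polynomial.natDegree_add_le _ _).trans (max_le (by simp) h3)
    exact ih h (by omega) hab s' h1 ⟨p, by rw [hh]; ring⟩

theorem ivt_of_max {E Ω : Type} [Field E] [LinearOrder E] [IsStrictOrderedRing E] [Field Ω]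
    [Algebra E Ω] [IsAlgClosed Ω]
    (hmax : ∀ θ : Ω, IsIntegral E θ → (∀ s ∈ sosT E, Polynomial.aeval θ s ≠ -1) →
      ∃ e : E, algebraMap E Ω e = θ) : IVTField E := by
  have key : ∀ N : ℕ, ∀ (p : Polynomial E) (a b : E), p.natDegree < N → a < b →
      p.eval a * p.eval b < 0 → ∃ c, a < c ∧ c < b ∧ p.eval c = 0 := by
    intro N
    induction N with
    | zero => intro p a b h; omega
    | succ N ih =>
      intro p a b hN hab hp
      have hd := natDegree_pos_of_sign hp
      have hp0 : p ≠ 0 := by rintro rfl; simp at hd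
      by_cases hirr : Irreducible p
      · obtain ⟨θ, hθ⟩ := IsAlgClosed.exists_aeval_eq_zero Ω p
          (by rw [Polynomial.degree_eq_natDegree hp0]; exact_mod_cast hd.ne')
        obtain ⟨e, he⟩ := hmax θ (IsAlgebraic.isIntegral ⟨p, hp0, hθ⟩) (by
          intro s hs hs1
          refine no_dvd_of_sign a b _ p (Nat.lt_succ_self _) hp s hs ?_
          by_contra hnd
          obtain ⟨u, v, huv⟩ := (hirr.coprime_iff_not_dvd).2 hnd
          have := congrArg (Polynomial.aeval θ) huv
          simp [hθ, hs1] at this)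
        have he0 : p.eval e = 0 := by
          rw [← he, Polynomial.aeval_algebraMap_apply] at hθ
          simpa [Polynomial.aeval_def] using hθ
        obtain ⟨v, hv⟩ := Polynomial.dvd_iff_isRoot.2 he0
        have hvu : IsUnit v := by
          rcases hirr.isUnit_or_isUnit hv with h | h
          · exact absurd h (Polynomial.not_isUnit_X_sub_C e)
          · exact h
        obtain ⟨u, hu, rfl⟩ := Polynomial.isUnit_iff.1 hvu
        rw [hv] at hp
        simp only [Polynomial.eval_mul, Polynomial.eval_sub, Polynomial.eval_X,
          Polynomial.eval_C] at hp
        have h2 : (a - e) * (b - e) < 0 := by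
          by_contra hc
          push Not at hc
          nlinarith [mul_nonneg hc (mul_self_nonneg u)]
        refine ⟨e, ?_, ?_, he0⟩
        · by_contra hc
          push Not at hc
          nlinarith [mul_nonneg (sub_nonneg.2 hc) (sub_nonneg.2 (hc.trans hab.le))]
        · by_contra hc
          push Not at hc
          nlinarith [mul_nonneg (sub_nonneg.2 hc) (sub_nonneg.2 (hab.le.trans hc))]
      · have hnu : ¬ IsUnit p := fun h => by
          rw [Polynomial.natDegree_eq_zero_of_isUnit h] at hd; omega
        rw [irreducible_iff] at hirr
        push Not at hirr
        obtain ⟨u, v, huv, hu, hv⟩ := hirr hnu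
        have hu0 : u ≠ 0 := by rintro rfl; simp at huv; exact hp0 huv
        have hv0 : v ≠ 0 := by rintro rfl; simp at huv; exact hp0 huv
        have hdu : 0 < u.natDegree := Nat.pos_of_ne_zero fun h => by
          apply hu
          rw [Polynomial.eq_C_of_natDegree_eq_zero h] at hu0 ⊢
          exact Polynomial.isUnit_C.2 (IsUnit.mk0 _ (by simpa using hu0))
        have hdv : 0 < v.natDegree := Nat.pos_of_ne_zero fun h => by
          apply hv
          rw [Polynomial.eq_C_of_natDegree_eq_zero h] at hv0 ⊢
          exact Polynomial.isUnit_C.2 (IsUnit.mk0 _ (by simpa using hv0))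
        have hdeg := Polynomial.natDegree_mul hu0 hv0
        rw [← huv] at hdeg
        have h3 : (u.eval a * u.eval b) * (v.eval a * v.eval b) < 0 := by
          rw [huv] at hp; simp only [Polynomial.eval_mul] at hp; nlinarith
        rcases lt_or_ge (u.eval a * u.eval b) 0 with h | h
        · obtain ⟨c, h4, h5, h6⟩ := ih u a b (by omega) hab h
          exact ⟨c, h4, h5, by rw [huv]; simp [h6]⟩
        · have h' : v.eval a * v.eval b < 0 := by
            by_contra hc; push Not at hc
            nlinarith [mul_nonneg h hc]
          obtain ⟨c, h4, h5, h6⟩ := ih v a b (by omega) hab h'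
          exact ⟨c, h4, h5, by rw [huv]; simp [h6]⟩
  intro p a b hab hp
  exact key _ p a b (Nat.lt_succ_self _) hab hp

def adjElt {A : Type} [CommRing A] (Q : Subsemiring A) (x : A) (hx : x ^ 2 ∈ Q) : Subsemiring A where
  carrier := {y | ∃ a ∈ Q, ∃ b ∈ Q, y = a + x * b}
  one_mem' := ⟨1, one_mem _, 0, zero_mem _, by simp⟩
  zero_mem' := ⟨0, zero_mem _, 0, zero_mem _, by simp⟩
  add_mem' := by
    rintro _ _ ⟨a, ha, b, hb, rfl⟩ ⟨c, hc, d, hd, rfl⟩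
    exact ⟨a + c, add_mem ha hc, b + d, add_mem hb hd, by ring⟩
  mul_mem' := by
    rintro _ _ ⟨a, ha, b, hb, rfl⟩ ⟨c, hc, d, hd, rfl⟩
    exact ⟨a * c + x ^ 2 * (b * d), add_mem (mul_mem ha hc) (mul_mem hx (mul_mem hb hd)),
      a * d + b * c, add_mem (mul_mem ha hd) (mul_mem hb hc), by ring⟩

theorem le_adjElt {A : Type} [CommRing A] (Q : Subsemiring A) (x : A) (hx : x ^ 2 ∈ Q) :
    Q ≤ adjElt Q x hx := fun a ha => ⟨a, ha, 0, zero_mem _, by simp⟩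

theorem mem_adjElt {A : Type} [CommRing A] (Q : Subsemiring A) (x : A) (hx : x ^ 2 ∈ Q) :
    x ∈ adjElt Q x hx := ⟨0, zero_mem _, 1, one_mem _, by simp⟩

def RPair {Ω : Type} [Field Ω] (z : Subfield Ω × Subsemiring Ω) : Prop :=
  (∀ x ∈ z.2, x ∈ z.1) ∧ (∀ x ∈ z.1, x ^ 2 ∈ z.2) ∧ (-1 : Ω) ∉ z.2

theorem exists_max_pair {Ω : Type} [Field Ω] (z0 : Subfield Ω × Subsemiring Ω) (h0 : RPair z0) :
    ∃ z, z0 ≤ z ∧ RPair z ∧ ∀ z', RPair z' → z ≤ z' → z' = z := by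
  obtain ⟨z, hz, hzm⟩ := zorn_le_nonempty₀ {z : Subfield Ω × Subsemiring Ω | RPair z} (by
    intro c hc hchain y hy
    have hd1 : DirectedOn (· ≤ ·) (Prod.fst '' c) := by
      rintro _ ⟨u, hu, rfl⟩ _ ⟨v, hv, rfl⟩
      rcases hchain.total hu hv with h | h
      · exact ⟨v.1, ⟨v, hv, rfl⟩, h.1, le_rfl⟩
      · exact ⟨u.1, ⟨u, hu, rfl⟩, le_rfl, h.1⟩
    have hd2 : DirectedOn (· ≤ ·) (Prod.snd '' c) := by
      rintro _ ⟨u, hu, rfl⟩ _ ⟨v, hv, rfl⟩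
      rcases hchain.total hu hv with h | h
      · exact ⟨v.2, ⟨v, hv, rfl⟩, h.2, le_rfl⟩
      · exact ⟨u.2, ⟨u, hu, rfl⟩, le_rfl, h.2⟩
    have hm1 : ∀ x, x ∈ sSup (Prod.fst '' c) ↔ ∃ u ∈ c, x ∈ u.1 := by
      intro x; rw [Subfield.mem_sSup_of_directedOn (Set.Nonempty.image _ ⟨y, hy⟩) hd1]; simp
    have hm2 : ∀ x, x ∈ sSup (Prod.snd '' c) ↔ ∃ u ∈ c, x ∈ u.2 := by
      intro x; rw [Subsemiring.mem_sSup_of_directedOn (Set.Nonempty.image _ ⟨y, hy⟩) hd2]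
      constructor
      · rintro ⟨_, ⟨u, hu, rfl⟩, hx⟩; exact ⟨u, hu, hx⟩
      · rintro ⟨u, hu, hx⟩; exact ⟨_, ⟨u, hu, rfl⟩, hx⟩
    refine ⟨(sSup (Prod.fst '' c), sSup (Prod.snd '' c)), ⟨?_, ?_, ?_⟩, ?_⟩
    · intro x hx
      obtain ⟨u, hu, hxu⟩ := (hm2 x).1 hx
      exact (hm1 x).2 ⟨u, hu, (hc hu).1 x hxu⟩
    · intro x hx
      obtain ⟨u, hu, hxu⟩ := (hm1 x).1 hx
      exact (hm2 _).2 ⟨u, hu, (hc hu).2.1 x hxu⟩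
    · intro hx
      obtain ⟨u, hu, hxu⟩ := (hm2 _).1 hx
      exact (hc hu).2.2 hxu
    · intro u hu
      exact ⟨fun x hx => (hm1 x).2 ⟨u, hu, hx⟩, fun x hx => (hm2 x).2 ⟨u, hu, hx⟩⟩) z0 h0
  exact ⟨z, hz, hzm.prop, fun z' h' hle => le_antisymm (hzm.le_of_ge h' hle) hle⟩

end RC

section RC2

theorem order_of_cone {L : Type} [Field L] (C : Subsemiring L)
    (h1 : ∀ x, x ∈ C → -x ∈ C → x = 0) (h2 : ∀ x, x ∈ C ∨ -x ∈ C) :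
    ∃ (_ : LinearOrder L) (_ : IsStrictOrderedRing L), ∀ x : L, 0 ≤ x ↔ x ∈ C := by
  classical
  let D : RingCone L := { C with eq_zero_of_mem_of_neg_mem' := fun {a} ha hb => h1 a ha hb }
  have : HasMemOrNegMem D := ⟨h2⟩
  let : LinearOrder L := LinearOrder.mkOfAddGroupCone D
  have : IsOrderedRing L := IsOrderedRing.mkOfCone D
  refine ⟨inferInstance, IsOrderedRing.toIsStrictOrderedRing L, fun x => ?_⟩
  change x - 0 ∈ C ↔ x ∈ C
  rw [sub_zero]

theorem max_pair_ivt {Ω : Type} [Field Ω] [IsAlgClosed Ω] (z : Subfield Ω × Subsemiring Ω)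
    (hz : RPair z) (hmax : ∀ z', RPair z' → z ≤ z' → z' = z) :
    ∃ (_ : LinearOrder z.1) (_ : IsStrictOrderedRing z.1), IVTField z.1 ∧
      ∀ x : z.1, 0 ≤ x ↔ (x : Ω) ∈ z.2 := by
  obtain ⟨E, P⟩ := z
  obtain ⟨hPE, hsq, hneg⟩ := hz
  simp only at hPE hsq hneg ⊢
  have anti : ∀ x : Ω, x ∈ P → -x ∈ P → x = 0 := by
    intro x h1 h2
    by_contra h0
    apply hneg
    have h3 := mul_mem (mul_mem h1 h2) (hsq x⁻¹ (inv_mem (hPE x h1)))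
    have : x * -x * x⁻¹ ^ 2 = -1 := by field_simp
    rwa [this] at h3
  have tot : ∀ x ∈ E, x ∈ P ∨ -x ∈ P := by
    intro x hx
    by_contra hc
    push Not at hc
    obtain ⟨hc1, hc2⟩ := hc
    have hx2 : (-x) ^ 2 ∈ P := hsq _ (neg_mem hx)
    by_cases hm : (-1 : Ω) ∈ adjElt P (-x) hx2
    · obtain ⟨a, ha, b, hb, hab⟩ := hm
      apply hc1
      have e : x * b = 1 + a := by linear_combination hab
      have hb0 : b ≠ 0 := by
        rintro rfl
        apply hneg
        have : a = -1 := by linear_combination -hab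
        rwa [this] at ha
      have : x = (1 + a) * b * b⁻¹ ^ 2 := by rw [← e]; field_simp
      rw [this]
      exact mul_mem (mul_mem (add_mem (one_mem _) ha) hb) (hsq _ (inv_mem (hPE _ hb)))
    · have h := hmax (E, adjElt P (-x) hx2) ⟨?_, ?_, hm⟩ ⟨le_rfl, le_adjElt P (-x) hx2⟩
      · have h' := congrArg Prod.snd h
        simp only at h'
        apply hc2
        rw [← h']
        exact mem_adjElt _ _ _
      · rintro y ⟨a, ha, b, hb, rfl⟩
        exact add_mem (hPE _ ha) (mul_mem (neg_mem hx) (hPE _ hb))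
      · intro y hy
        exact le_adjElt P (-x) hx2 (hsq y hy)
  obtain ⟨o1, o2, ho⟩ := order_of_cone (L := E) (P.comap E.subtype)
    (fun x h1 h2 => Subtype.ext (anti x h1 (by simpa using h2)))
    (fun x => by simpa using tot x x.2)
  refine ⟨o1, o2, ?_, fun x => by rw [ho]; rfl⟩
  refine ivt_of_max (Ω := Ω) ?_
  intro θ hθ hs
  let E' : Subfield Ω := (IntermediateField.adjoin E {θ}).toSubfield
  let P' : Subsemiring Ω := (sosT E).map (Polynomial.aeval (R := E) θ).toRingHom
  have hE' : ∀ x, x ∈ E' ↔ ∃ f : Polynomial E, Polynomial.aeval θ f = x := by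
    intro x
    have h1 : x ∈ E' ↔ x ∈ (IntermediateField.adjoin E {θ}).toSubalgebra := Iff.rfl
    rw [h1, IntermediateField.adjoin_simple_toSubalgebra_of_isAlgebraic hθ.isAlgebraic,
      Algebra.adjoin_singleton_eq_range_aeval]
    rfl
  have h := hmax (E', P') ⟨?_, ?_, ?_⟩ ⟨?_, ?_⟩
  · have h' := congrArg Prod.fst h
    simp only at h'
    have hm : θ ∈ E' := (hE' θ).2 ⟨Polynomial.X, by simp⟩
    rw [h'] at hm
    exact ⟨⟨θ, hm⟩, rfl⟩
  · rintro x ⟨s, _, rfl⟩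
    exact (hE' _).2 ⟨s, rfl⟩
  · intro x hx
    obtain ⟨f, rfl⟩ := (hE' x).1 hx
    exact ⟨Polynomial.C 1 * f ^ 2, sosT_mem _ _ zero_le_one, by simp⟩
  · rintro ⟨s, hs1, hs2⟩
    exact hs s hs1 hs2
  · intro x hx
    exact (hE' x).2 ⟨Polynomial.C ⟨x, hx⟩, by simp; rfl⟩
  · intro x hx
    refine ⟨Polynomial.C ⟨x, hPE x hx⟩ * 1 ^ 2, sosT_mem _ _ ((ho _).2 hx), ?_⟩
    simp; rfl

theorem exists_max_preord {A : Type} [CommRing A] (P : Subsemiring A) (hsq : ∀ a, a ^ 2 ∈ P)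
    (hneg : (-1 : A) ∉ P) : ∃ Q : Subsemiring A, P ≤ Q ∧ (-1 : A) ∉ Q ∧
      ∀ x, x ∉ Q → ∃ a ∈ Q, ∃ b ∈ Q, -1 = a + x * b := by
  obtain ⟨Q, hQ, hQm⟩ := zorn_le_nonempty₀ {Q : Subsemiring A | (-1 : A) ∉ Q} (by
    intro c hc hchain y hy
    refine ⟨sSup c, ?_, fun u hu => le_sSup hu⟩
    intro hx
    obtain ⟨u, hu, hxu⟩ := (Subsemiring.mem_sSup_of_directedOn ⟨y, hy⟩ hchain.directedOn).1 hx
    exact hc hu hxu) P hneg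
  refine ⟨Q, hQ, hQm.prop, fun x hx => ?_⟩
  by_contra hc
  apply hx
  have hle := hQm.le_of_ge (y := adjElt Q x (hQ (hsq x))) (fun h => hc h) (le_adjElt _ _ _)
  exact hle (mem_adjElt _ _ _)

theorem exists_real_point {A : Type} [CommRing A] (P : Subsemiring A) (hsq0 : ∀ a, a ^ 2 ∈ P)
    (hneg0 : (-1 : A) ∉ P) : ∃ (R : Type) (_ : Field R) (_ : LinearOrder R)
      (_ : IsStrictOrderedRing R), IVTField R ∧ ∃ φ : A →+* R, ∀ a ∈ P, 0 ≤ φ a := by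
  obtain ⟨Q, hPQ, hneg, hmax⟩ := exists_max_preord P hsq0 hneg0
  have hsq : ∀ a, a ^ 2 ∈ Q := fun a => hPQ (hsq0 a)
  have tot : ∀ x, x ∈ Q ∨ -x ∈ Q := by
    intro x
    by_contra hc
    push Not at hc
    obtain ⟨a, ha, b, hb, h1⟩ := hmax x hc.1
    obtain ⟨c, hc', d, hd, h2⟩ := hmax (-x) hc.2
    apply hneg
    have : (-1 : A) = a + c + a * c + x ^ 2 * (b * d) := by
      linear_combination (1 + c) * h1 - (x * b) * h2
    rw [this]
    exact add_mem (add_mem (add_mem ha hc') (mul_mem ha hc')) (mul_mem (hsq x) (mul_mem hb hd))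
  let I : Ideal A :=
    { carrier := {x | x ∈ Q ∧ -x ∈ Q}
      add_mem' := by
        rintro x y ⟨h1, h2⟩ ⟨h3, h4⟩
        exact ⟨add_mem h1 h3, by rw [neg_add]; exact add_mem h2 h4⟩
      zero_mem' := ⟨zero_mem _, by simp⟩
      smul_mem' := by
        rintro a x ⟨h1, h2⟩
        rcases tot a with h | h
        · exact ⟨mul_mem h h1, by
            have := mul_mem h h2
            simpa using this⟩
        · exact ⟨by have := mul_mem h h2; simpa using this, by
            have := mul_mem h h1; simpa using this⟩ }
  have hI : ∀ x, x ∈ I ↔ x ∈ Q ∧ -x ∈ Q := fun x => Iff.rfl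
  have hone : (1 : A) ∉ I := fun h => hneg h.2
  have hkey : ∀ u v, u ∉ Q → v ∉ Q → u * v ∉ I := by
    intro u v hu hv huv
    obtain ⟨a, ha, b, hb, h1⟩ := hmax u hu
    obtain ⟨c, hc, d, hd, h2⟩ := hmax v hv
    have h3 : (u * v) * (b * d) ∈ I := I.mul_mem_right _ huv
    apply hneg
    have : (-1 : A) = (a + c + a * c) + -((u * v) * (b * d)) := by
      linear_combination (1 + c) * h1 - (u * b) * h2
    rw [this]
    exact add_mem (add_mem (add_mem ha hc) (mul_mem ha hc)) h3.2
  have hprime : I.IsPrime := by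
    refine ⟨fun h => hone (h ▸ Submodule.mem_top), fun {u v} huv => ?_⟩
    by_contra hc
    push Not at hc
    obtain ⟨hu, hv⟩ := hc
    have hnu : u ∉ Q ∨ -u ∉ Q := by
      by_contra h; push Not at h; exact hu h
    have hnv : v ∉ Q ∨ -v ∉ Q := by
      by_contra h; push Not at h; exact hv h
    have hn : -(u * v) ∈ I := I.neg_mem huv
    rcases hnu with h | h <;> rcases hnv with h' | h'
    · exact hkey u v h h' huv
    · exact hkey u (-v) h h' (by simpa using hn)
    · exact hkey (-u) v h h' (by simpa using hn)
    · exact hkey (-u) (-v) h h' (by simpa using huv)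
  let F := FractionRing (A ⧸ I)
  let Ω := AlgebraicClosure F
  let ψ : A →+* Ω := (algebraMap F Ω).comp ((algebraMap (A ⧸ I) F).comp (Ideal.Quotient.mk I))
  have hψ : ∀ x, ψ x = 0 ↔ x ∈ I := by
    intro x
    rw [← Ideal.Quotient.eq_zero_iff_mem]
    change (algebraMap F Ω) ((algebraMap (A ⧸ I) F) (Ideal.Quotient.mk I x)) = 0 ↔ _
    rw [map_eq_zero_iff _ (algebraMap F Ω).injective,
      map_eq_zero_iff _ (IsFractionRing.injective (A ⧸ I) F)]
  let E0 : Subfield Ω := (algebraMap F Ω).fieldRange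
  have hψE : ∀ x, ψ x ∈ E0 := fun x => ⟨_, rfl⟩
  have hE0 : ∀ x ∈ E0, ∃ a d : A, d ∉ I ∧ x * ψ d = ψ a := by
    rintro x ⟨y, rfl⟩
    obtain ⟨a, d, hd, rfl⟩ := IsFractionRing.div_surjective (A := A ⧸ I) y
    obtain ⟨a, rfl⟩ := Ideal.Quotient.mk_surjective a
    obtain ⟨d, rfl⟩ := Ideal.Quotient.mk_surjective d
    have hdI : d ∉ I := by
      rw [← Ideal.Quotient.eq_zero_iff_mem]
      exact nonZeroDivisors.ne_zero hd
    refine ⟨a, d, hdI, ?_⟩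
    have hne : ψ d ≠ 0 := fun h => hdI ((hψ d).1 h)
    rw [map_div₀]
    change ψ a / ψ d * ψ d = ψ a
    exact div_mul_cancel₀ _ hne
  let P0 : Subsemiring Ω :=
    { carrier := {x | ∃ q ∈ Q, ∃ d, d ∉ I ∧ x * ψ d ^ 2 = ψ q}
      one_mem' := ⟨1, one_mem _, 1, hone, by simp⟩
      zero_mem' := ⟨0, zero_mem _, 1, hone, by simp⟩
      add_mem' := by
        rintro x y ⟨q, hq, d, hd, h1⟩ ⟨r, hr, e, he, h2⟩
        refine ⟨q * e ^ 2 + r * d ^ 2, add_mem (mul_mem hq (hsq _)) (mul_mem hr (hsq _)),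
          d * e, fun h => ?_, ?_⟩
        · rcases hprime.mem_or_mem h with h | h
          exacts [hd h, he h]
        · simp only [map_add, map_mul, map_pow]
          linear_combination (ψ e ^ 2) * h1 + (ψ d ^ 2) * h2
      mul_mem' := by
        rintro x y ⟨q, hq, d, hd, h1⟩ ⟨r, hr, e, he, h2⟩
        refine ⟨q * r, mul_mem hq hr, d * e, fun h => ?_, ?_⟩
        · rcases hprime.mem_or_mem h with h | h
          exacts [hd h, he h]
        · simp only [map_mul]
          linear_combination (y * ψ e ^ 2) * h1 + ψ q * h2 }
  have hz0 : RPair (E0, P0) := by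
    refine ⟨?_, ?_, ?_⟩
    · rintro x ⟨q, hq, d, hd, h1⟩
      have hne : ψ d ≠ 0 := fun h => hd ((hψ d).1 h)
      have : x = ψ q / ψ d ^ 2 := (eq_div_iff (pow_ne_zero 2 hne)).2 h1
      rw [this]
      exact div_mem (hψE _) (pow_mem (hψE _) _)
    · intro x hx
      obtain ⟨a, d, hd, h1⟩ := hE0 x hx
      exact ⟨a ^ 2, hsq _, d, hd, by rw [← mul_pow, h1, map_pow]⟩
    · rintro ⟨q, hq, d, hd, h1⟩
      have h2 : q + d ^ 2 ∈ I := by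
        rw [← hψ, map_add, map_pow]; linear_combination -h1
      apply hd
      refine hprime.mem_of_pow_mem 2 ⟨hsq d, ?_⟩
      have := add_mem hq h2.2
      convert this using 1; ring
  obtain ⟨z, hle, hz, hzm⟩ := exists_max_pair (E0, P0) hz0
  obtain ⟨o1, o2, hivt, ho⟩ := max_pair_ivt z hz hzm
  refine ⟨z.1, inferInstance, o1, o2, hivt,
    ψ.codRestrict z.1 (fun x => hle.1 (hψE x)), fun a ha => ?_⟩
  rw [ho]
  exact hle.2 ⟨a, hPQ ha, 1, hone, by simp⟩

end RC2

section Schm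

theorem isSOS_iff {ι : Type*} (q : MvPolynomial ι ℝ) : IsSOS q ↔ IsSumSq q := by
  constructor
  · rintro ⟨k, s, rfl⟩
    exact IsSumSq.sum fun i _ => by rw [sq]; exact IsSumSq.mul_self _
  · intro h
    induction h with
    | zero => exact ⟨0, Fin.elim0, by simp⟩
    | sq_add a _ ih =>
      obtain ⟨k, s, rfl⟩ := ih
      exact ⟨k + 1, Fin.cons a s, by simp [Fin.sum_univ_succ, sq]⟩

variable {ι κ : Type} [Fintype κ] [DecidableEq κ] (g : κ → MvPolynomial ι ℝ)

theorem inP_add {a b : MvPolynomial ι ℝ} (ha : InPreordering g a) (hb : InPreordering g b) :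
    InPreordering g (a + b) := by
  obtain ⟨c, hc, rfl⟩ := ha
  obtain ⟨d, hd, rfl⟩ := hb
  refine ⟨fun J => c J + d J, fun J => ?_, ?_⟩
  · have h1 := hc J
    have h2 := hd J
    rw [isSOS_iff] at *
    exact h1.add h2
  · rw [← Finset.sum_add_distrib]
    exact Finset.sum_congr rfl fun J _ => by ring

theorem inP_zero : InPreordering g 0 :=
  ⟨fun _ => 0, fun _ => (isSOS_iff _).2 IsSumSq.zero, by simp⟩

theorem inP_sum {α : Type} (s : Finset α) (F : α → MvPolynomial ι ℝ)
    (h : ∀ i ∈ s, InPreordering g (F i)) : InPreordering g (∑ i ∈ s, F i) := by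
  classical
  induction s using Finset.induction_on with
  | empty => simpa using inP_zero g
  | insert a s ha ih =>
    rw [Finset.sum_insert ha]
    exact inP_add g (h _ (by simp)) (ih fun i hi => h i (by simp [hi]))

theorem inP_term (c : MvPolynomial ι ℝ) (hc : IsSumSq c) (J : Finset κ) :
    InPreordering g (c * ∏ j ∈ J, g j) := by
  refine ⟨fun L => if L = J then c else 0, fun L => ?_, ?_⟩
  · rw [isSOS_iff]
    dsimp only
    split_ifs
    exacts [hc, IsSumSq.zero]
  · simp

theorem inP_sos_mul (s : MvPolynomial ι ℝ) (hs : IsSumSq s) {a : MvPolynomial ι ℝ}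
    (ha : InPreordering g a) : InPreordering g (s * a) := by
  obtain ⟨c, hc, rfl⟩ := ha
  rw [Finset.mul_sum]
  refine inP_sum g _ _ fun J _ => ?_
  rw [← mul_assoc]
  exact inP_term g _ (hs.mul ((isSOS_iff _).1 (hc J))) J

theorem inP_gen_mul (j : κ) {a : MvPolynomial ι ℝ}
    (ha : InPreordering g a) : InPreordering g (g j * a) := by
  obtain ⟨c, hc, rfl⟩ := ha
  rw [Finset.mul_sum]
  refine inP_sum g _ _ fun J _ => ?_
  by_cases hj : j ∈ J
  · have : g j * (c J * ∏ i ∈ J, g i) = (c J * (g j * g j)) * ∏ i ∈ J.erase j, g i := by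
      rw [← Finset.mul_prod_erase J g hj]; ring
    rw [this]
    exact inP_term g _ (((isSOS_iff _).1 (hc J)).mul (IsSumSq.mul_self _)) _
  · have : g j * (c J * ∏ i ∈ J, g i) = c J * ∏ i ∈ insert j J, g i := by
      rw [Finset.prod_insert hj]; ring
    rw [this]
    exact inP_term g _ ((isSOS_iff _).1 (hc J)) _

theorem inP_prod_mul (J : Finset κ) {a : MvPolynomial ι ℝ}
    (ha : InPreordering g a) : InPreordering g ((∏ j ∈ J, g j) * a) := by
  induction J using Finset.induction_on with
  | empty => simpa using ha
  | insert j s hj ih =>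
    rw [Finset.prod_insert hj, mul_assoc]
    exact inP_gen_mul g j ih

theorem inP_sq (a : MvPolynomial ι ℝ) : InPreordering g (a ^ 2) := by
  have := inP_term g (a ^ 2) (by rw [sq]; exact IsSumSq.mul_self _) ∅
  simpa using this

def preord : Subsemiring (MvPolynomial ι ℝ) where
  carrier := {a | InPreordering g a}
  zero_mem' := inP_zero g
  one_mem' := by simpa using inP_sq g 1
  add_mem' := fun ha hb => inP_add g ha hb
  mul_mem' := by
    rintro a b ⟨c, hc, rfl⟩ hb
    change InPreordering g _
    rw [Finset.sum_mul]
    refine inP_sum g _ _ fun J _ => ?_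
    rw [mul_assoc]
    exact inP_sos_mul g _ ((isSOS_iff _).1 (hc J)) (inP_prod_mul g J hb)

theorem preord_sq (a : MvPolynomial ι ℝ) : a ^ 2 ∈ preord g := inP_sq g a

theorem preord_gen (j : κ) : g j ∈ preord g := by
  have := inP_gen_mul g j (one_mem (preord g))
  rw [mul_one] at this
  exact this

theorem C_mem (P : Subsemiring (MvPolynomial ι ℝ)) (hsq : ∀ a, a ^ 2 ∈ P) (r : ℝ) (hr : 0 ≤ r) :
    (C r : MvPolynomial ι ℝ) ∈ P := by
  have := hsq (C (Real.sqrt r))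
  rwa [← C_pow, Real.sq_sqrt hr] at this

variable [Fintype ι]

theorem stengle (f : MvPolynomial ι ℝ)
    (hf : ∀ x : ι → ℝ, (∀ j, 0 ≤ eval x (g j)) → 0 < eval x f) :
    ∃ s ∈ preord g, ∃ t ∈ preord g, s * f = 1 + t := by
  classical
  have hsq := preord_sq g
  by_cases h : (-1 : MvPolynomial ι ℝ) ∈ adjElt (preord g) (-f) (hsq _)
  · obtain ⟨a, ha, b, hb, hab⟩ := h
    exact ⟨b, hb, a, ha, by linear_combination hab⟩
  · exfalso
    obtain ⟨R, i1, i2, i3, hR, φ, hφ⟩ := exists_real_point (adjElt (preord g) (-f) (hsq _))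
      (fun a => le_adjElt _ _ _ (hsq a)) h
    obtain ⟨x, hx⟩ := transfer_real hR φ (insert (-f) (Finset.univ.image g)) (by
      intro p hp
      apply hφ
      rcases Finset.mem_insert.1 hp with rfl | hp
      · exact mem_adjElt _ _ _
      · obtain ⟨j, -, rfl⟩ := Finset.mem_image.1 hp
        exact le_adjElt _ _ _ (preord_gen g j))
    have h1 := hf x fun j => hx _ (Finset.mem_insert_of_mem (Finset.mem_image_of_mem g (by simp)))
    have h2 := hx (-f) (Finset.mem_insert_self _ _)
    rw [map_neg] at h2
    linarith

theorem arch_of_ball (P : Subsemiring (MvPolynomial ι ℝ)) (hsq : ∀ a, a ^ 2 ∈ P) (c : ℝ)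
    (hc : C c - ∑ i, X i ^ 2 ∈ P) (a : MvPolynomial ι ℝ) :
    ∃ N : ℝ, C N - a ∈ P ∧ C N + a ∈ P := by
  classical
  have hmul : ∀ a b : MvPolynomial ι ℝ, (∃ N : ℝ, C N - a ∈ P ∧ C N + a ∈ P) →
      (∃ N : ℝ, C N - b ∈ P ∧ C N + b ∈ P) → ∃ N : ℝ, C N - a * b ∈ P ∧ C N + a * b ∈ P := by
    rintro a b ⟨N, h1, h2⟩ ⟨M, h3, h4⟩
    have hh : (C (1 / 2) : MvPolynomial ι ℝ) ∈ P := C_mem P hsq _ (by norm_num)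
    have e : (C (1 / 2) : MvPolynomial ι ℝ) * 2 = 1 := by
      rw [show (2 : MvPolynomial ι ℝ) = C 2 from rfl, ← C_mul]; norm_num
    refine ⟨N * M, ?_, ?_⟩
    · have := mul_mem hh (add_mem (mul_mem h1 h4) (mul_mem h2 h3))
      convert this using 1
      rw [C_mul]
      linear_combination (-(C N * C M - a * b)) * e
    · have := mul_mem hh (add_mem (mul_mem h2 h4) (mul_mem h1 h3))
      convert this using 1
      rw [C_mul]
      linear_combination (-(C N * C M + a * b)) * e
  induction a using MvPolynomial.induction_on with
  | C r =>
    refine ⟨|r|, ?_, ?_⟩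
    · rw [← C_sub]; exact C_mem P hsq _ (by linarith [le_abs_self r])
    · rw [← C_add]; exact C_mem P hsq _ (by linarith [neg_abs_le r])
  | add a b ha hb =>
    obtain ⟨N, h1, h2⟩ := ha
    obtain ⟨M, h3, h4⟩ := hb
    refine ⟨N + M, ?_, ?_⟩
    · convert add_mem h1 h3 using 1; rw [C_add]; ring
    · convert add_mem h2 h4 using 1; rw [C_add]; ring
  | mul_X a i ha =>
    refine hmul a (X i) ha ?_
    have h1 : C c - X i ^ 2 ∈ P := by
      have : C c - X i ^ 2 = (C c - ∑ j, X j ^ 2) +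
          ∑ j ∈ Finset.univ.erase i, (X j : MvPolynomial ι ℝ) ^ 2 := by
        rw [← Finset.add_sum_erase Finset.univ _ (Finset.mem_univ i)]; ring
      rw [this]
      exact add_mem hc (sum_mem fun j _ => hsq _)
    have e : (C (1 / 2) : MvPolynomial ι ℝ) * 2 = 1 := by
      rw [show (2 : MvPolynomial ι ℝ) = C 2 from rfl, ← C_mul]; norm_num
    have e4 : (C (1 / 4) : MvPolynomial ι ℝ) = C (1 / 2) ^ 2 := by
      rw [← C_pow]; norm_num
    refine ⟨c + 1 / 4, ?_, ?_⟩
    · have := add_mem h1 (hsq (X i - C (1 / 2)))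
      convert this using 1
      rw [C_add, e4]
      linear_combination X i * e
    · have := add_mem h1 (hsq (X i + C (1 / 2)))
      convert this using 1
      rw [C_add, e4]
      linear_combination (-X i) * e

theorem preord_arch (hK : IsCompact {x : ι → ℝ | ∀ j, 0 ≤ eval x (g j)}) (a : MvPolynomial ι ℝ) :
    ∃ N : ℝ, C N - a ∈ preord g ∧ C N + a ∈ preord g := by
  have hsq := preord_sq g
  set q : MvPolynomial ι ℝ := ∑ i, X i ^ 2 with hq
  have hqP : q ∈ preord g := sum_mem fun j _ => hsq _
  obtain ⟨c, hc0, hc⟩ : ∃ c : ℝ, 0 ≤ c ∧ ∀ x : ι → ℝ, (∀ j, 0 ≤ eval x (g j)) →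
      0 < eval x (C c - q) := by
    obtain ⟨B, hB⟩ := hK.bddAbove_image (f := fun x => eval x q)
      (MvPolynomial.continuous_eval q).continuousOn
    refine ⟨|B| + 1, by positivity, fun x hx => ?_⟩
    have := hB ⟨x, hx, rfl⟩
    simp only at this
    rw [map_sub, eval_C]
    linarith [le_abs_self B]
  obtain ⟨s, hs, t, ht, hst⟩ := stengle g _ hc
  obtain ⟨N, hN, -⟩ := arch_of_ball (adjElt (preord g) (C c - q) (hsq _))
    (fun a => le_adjElt _ _ _ (hsq a)) c (mem_adjElt _ _ _) t
  have hmul : ∀ y ∈ adjElt (preord g) (C c - q) (hsq _), (1 + t) * y ∈ preord g := by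
    rintro y ⟨a, ha, b, hb, rfl⟩
    have : (1 + t) * (a + (C c - q) * b) = (1 + t) * a + s * ((C c - q) ^ 2 * b) := by
      rw [← hst]; ring
    rw [this]
    exact add_mem (mul_mem (add_mem (one_mem _) ht) ha) (mul_mem hs (mul_mem (hsq _) hb))
  have e : (C (1 / 2) : MvPolynomial ι ℝ) * 2 = 1 := by
    rw [show (2 : MvPolynomial ι ℝ) = C 2 from rfl, ← C_mul]; norm_num
  have e2 : (C (N / 2) : MvPolynomial ι ℝ) = C N * C (1 / 2) := by
    rw [← C_mul]; congr 1; ring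
  have hM : C (N + (N / 2) ^ 2) - t ∈ preord g := by
    have := add_mem (hmul _ hN) (hsq (t - C (N / 2)))
    convert this using 1
    rw [C_add, C_pow, e2]
    linear_combination (C N * t) * e
  have h1 : C c * (1 + t) - q ∈ preord g := by
    have := add_mem (hmul _ (mem_adjElt _ _ _)) (mul_mem ht hqP)
    convert this using 1
    ring
  refine arch_of_ball (preord g) hsq (c * (1 + (N + (N / 2) ^ 2))) ?_ a
  have := add_mem h1 (mul_mem (C_mem _ hsq c hc0) hM)
  convert this using 1
  rw [C_mul, C_add, C_1]
  ring

theorem schmudgen (hK : IsCompact {x : ι → ℝ | ∀ j, 0 ≤ eval x (g j)}) (f : MvPolynomial ι ℝ)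
    (hf : ∀ x : ι → ℝ, (∀ j, 0 ≤ eval x (g j)) → 0 < eval x f) : InPreordering g f := by
  have hsq := preord_sq g
  change f ∈ preord g
  obtain ⟨s, hs, t, ht, hst⟩ := stengle g f hf
  obtain ⟨N, hN0, hN⟩ : ∃ N : ℝ, 0 < N ∧ C N - s ∈ preord g := by
    obtain ⟨N, hN, -⟩ := preord_arch g hK s
    refine ⟨|N| + 1, by positivity, ?_⟩
    have := add_mem hN (C_mem _ hsq (|N| + 1 - N) (by linarith [le_abs_self N]))
    convert this using 1
    rw [C_sub]; ring
  obtain ⟨r, hr⟩ : ∃ r : ℝ, f + C r ∈ preord g := by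
    obtain ⟨r, -, hr⟩ := preord_arch g hK f
    exact ⟨r, by rwa [add_comm]⟩
  have key : ∀ k : ℕ, f ∈ preord g ∨ f + C (r - k / N) ∈ preord g := by
    intro k
    induction k with
    | zero => right; simpa using hr
    | succ k ih =>
      rcases ih with ih | ih
      · exact Or.inl ih
      · rcases lt_or_ge (r - k / N) 0 with h | h
        · left
          have := add_mem ih (C_mem _ hsq (-(r - k / N)) (by linarith))
          convert this using 1
          rw [C_neg]; ring
        · right
          have h1 := add_mem (add_mem (mul_mem hN ih) ht) (mul_mem (C_mem _ hsq _ h) hs)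
          have h2 := mul_mem (C_mem _ hsq (1 / N) (by positivity)) h1
          convert h2 using 1
          have e : (C (1 / N) : MvPolynomial ι ℝ) * C N = 1 := by
            rw [← C_mul, one_div_mul_cancel hN0.ne', C_1]
          have e2 : (C (r - ((k + 1 : ℕ) : ℝ) / N) : MvPolynomial ι ℝ) =
              C (r - k / N) - C (1 / N) := by
            rw [← C_sub]; congr 1; push_cast; ring
          rw [e2]
          linear_combination (-(f + C (r - k / N))) * e + C (1 / N) * hst
  obtain ⟨k, hk⟩ := exists_nat_gt (r * N)
  rcases key k with h | h
  · exact h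
  · have hneg : r - k / N < 0 := by
      rw [sub_neg, lt_div_iff₀ hN0]; exact hk
    have := add_mem h (C_mem _ hsq (-(r - k / N)) (by linarith))
    convert this using 1
    rw [C_neg]; ring

end Schm

section Sep

theorem between {U V : Set ℝ} (hU : IsCompact U) (hV : IsCompact V)
    (h : ∀ a ∈ U, ∀ b ∈ V, b < a) : ∃ c, (∀ a ∈ U, c < a) ∧ ∀ b ∈ V, b < c := by
  rcases U.eq_empty_or_nonempty with rfl | hUn
  · obtain ⟨M, hM⟩ := hV.bddAbove
    exact ⟨M + 1, by simp, fun b hb => by linarith [hM hb]⟩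
  rcases V.eq_empty_or_nonempty with rfl | hVn
  · obtain ⟨M, hM⟩ := hU.bddBelow
    exact ⟨M - 1, fun b hb => by linarith [hM hb], by simp⟩
  obtain ⟨a, ha, hamin⟩ := hU.exists_isLeast hUn
  obtain ⟨b, hb, hbmax⟩ := hV.exists_isGreatest hVn
  have := h a ha b hb
  exact ⟨(a + b) / 2, fun x hx => by linarith [hamin hx], fun x hx => by linarith [hbmax hx]⟩

theorem sep_continuous {X Y Z : Type} [TopologicalSpace X] [MetricSpace Y] [TopologicalSpace Z]
    [T2Space X] [T2Space Z]
    {A : Set (X × Y)} {B : Set (Y × Z)} (hA : IsCompact A) (hB : IsCompact B)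
    {u : X × Y → ℝ} {v : Y × Z → ℝ} (hu : Continuous u) (hv : Continuous v)
    (h : ∀ x y z, (x, y) ∈ A → (y, z) ∈ B → 0 < u (x, y) + v (y, z)) :
    ∃ q : C(Y, ℝ), (∀ w ∈ A, q w.2 < u w) ∧ ∀ w ∈ B, -v w < q w.1 := by
  obtain ⟨q, hq⟩ := exists_continuous_forall_mem_convex_of_local_const
    (t := fun y => {c : ℝ | (∀ w ∈ A, w.2 = y → c < u w) ∧ ∀ w ∈ B, w.1 = y → -v w < c})
    (by
      intro y c hc d hd a b ha hb hab
      refine ⟨fun w hw hy => ?_, fun w hw hy => ?_⟩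
      · have h1 := hc.1 w hw hy
        have h2 := hd.1 w hw hy
        exact (convex_Iio (u w)) h1 h2 ha hb hab
      · have h1 := hc.2 w hw hy
        have h2 := hd.2 w hw hy
        exact (convex_Ioi (-v w)) h1 h2 ha hb hab)
    (by
      intro y
      have cA : IsCompact (A ∩ {w | w.2 = y}) :=
        hA.inter_right (isClosed_eq continuous_snd continuous_const)
      have cB : IsCompact (B ∩ {w | w.1 = y}) :=
        hB.inter_right (isClosed_eq continuous_fst continuous_const)
      obtain ⟨c, hc1, hc2⟩ := between (cA.image hu) (cB.image hv.neg) (by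
        rintro _ ⟨⟨x, y1⟩, ⟨hw, hy1⟩, rfl⟩ _ ⟨⟨y2, z⟩, ⟨hw', hy2⟩, rfl⟩
        simp only [Set.mem_ofPred_eq] at hy1 hy2
        subst hy1; subst hy2
        have := h _ _ _ hw hw'
        rw [Pi.neg_apply]
        linarith)
      refine ⟨c, ?_⟩
      have cA' : IsCompact (A ∩ {w | u w ≤ c}) :=
        hA.inter_right (isClosed_le hu continuous_const)
      have cB' : IsCompact (B ∩ {w | c ≤ -v w}) :=
        hB.inter_right (isClosed_le continuous_const hv.neg)
      have n1 : (Prod.snd '' (A ∩ {w | u w ≤ c}))ᶜ ∈ nhds y := by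
        refine (cA'.image continuous_snd).isClosed.isOpen_compl.mem_nhds ?_
        rintro ⟨w, ⟨hw, hwc⟩, hwy⟩
        exact absurd (hc1 (u w) ⟨w, ⟨hw, hwy⟩, rfl⟩) (not_lt.2 hwc)
      have n2 : (Prod.fst '' (B ∩ {w | c ≤ -v w}))ᶜ ∈ nhds y := by
        refine (cB'.image continuous_fst).isClosed.isOpen_compl.mem_nhds ?_
        rintro ⟨w, ⟨hw, hwc⟩, hwy⟩
        exact absurd (hc2 (-v w) ⟨w, ⟨hw, hwy⟩, rfl⟩) (not_lt.2 hwc)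
      filter_upwards [n1, n2] with y' h1 h2
      refine ⟨fun w hw hy => ?_, fun w hw hy => ?_⟩
      · by_contra hcon
        exact h1 ⟨w, ⟨hw, not_lt.1 hcon⟩, hy⟩
      · by_contra hcon
        exact h2 ⟨w, ⟨hw, not_lt.1 hcon⟩, hy⟩)
  exact ⟨q, fun w hw => (hq w.2).1 w hw rfl, fun w hw => (hq w.1).2 w hw rfl⟩

theorem mv_approx {m : ℕ} (K : Set (Fin m → ℝ)) (hK : IsCompact K) (q : C(Fin m → ℝ, ℝ))
    (ε : ℝ) (hε : 0 < ε) : ∃ p : MvPolynomial (Fin m) ℝ, ∀ y ∈ K, |eval y p - q y| < ε := by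
  let F : MvPolynomial (Fin m) ℝ →ₐ[ℝ] C(Fin m → ℝ, ℝ) :=
    MvPolynomial.aeval fun i => (⟨fun y => y i, continuous_apply i⟩ : C(Fin m → ℝ, ℝ))
  have hF : ∀ p y, F p y = eval y p := by
    intro p y
    induction p using MvPolynomial.induction_on with
    | C r => simp [F]
    | add a b ha hb => rw [map_add, ContinuousMap.add_apply, ha, hb, map_add]
    | mul_X a i ha =>
      rw [map_mul, ContinuousMap.mul_apply, ha, map_mul]
      simp [F]
  obtain ⟨_, ⟨p, rfl⟩, hp⟩ :=
    ContinuousMap.exists_mem_subalgebra_near_continuous_of_isCompact_of_separatesPoints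
      (A := F.range) (by
        intro x y hxy
        obtain ⟨i, hi⟩ := Function.ne_iff.1 hxy
        refine ⟨_, ⟨F (X i), ⟨X i, rfl⟩, rfl⟩, ?_⟩
        simpa [hF] using hi) q hK hε
  refine ⟨p, fun y hy => ?_⟩
  rw [← hF]
  exact hp y hy

theorem sep_poly {m : ℕ} {X Z : Type} [TopologicalSpace X] [TopologicalSpace Z]
    [T2Space X] [T2Space Z]
    {A : Set (X × (Fin m → ℝ))} {B : Set ((Fin m → ℝ) × Z)} (hA : IsCompact A) (hB : IsCompact B)
    {u : X × (Fin m → ℝ) → ℝ} {v : (Fin m → ℝ) × Z → ℝ} (hu : Continuous u) (hv : Continuous v)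
    (h : ∀ x y z, (x, y) ∈ A → (y, z) ∈ B → 0 < u (x, y) + v (y, z)) :
    ∃ q : MvPolynomial (Fin m) ℝ, (∀ w ∈ A, eval w.2 q < u w) ∧ ∀ w ∈ B, -v w < eval w.1 q := by
  obtain ⟨q, h1, h2⟩ := sep_continuous hA hB hu hv h
  obtain ⟨e1, he1, h1'⟩ := hA.exists_forall_le' (f := fun w => u w - q w.2) (a := 0)
    (by fun_prop) (fun w hw => by linarith [h1 w hw])
  obtain ⟨e2, he2, h2'⟩ := hB.exists_forall_le' (f := fun w => q w.1 + v w) (a := 0)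
    (by fun_prop) (fun w hw => by linarith [h2 w hw])
  obtain ⟨p, hp⟩ := mv_approx (Prod.snd '' A ∪ Prod.fst '' B)
    ((hA.image continuous_snd).union (hB.image continuous_fst)) q (min e1 e2) (lt_min he1 he2)
  refine ⟨p, fun w hw => ?_, fun w hw => ?_⟩
  · have h3 := abs_lt.1 (hp w.2 (Or.inl ⟨w, hw, rfl⟩))
    have h4 := h1' w hw
    have := min_le_left e1 e2
    linarith [h3.2]
  · have h3 := abs_lt.1 (hp w.1 (Or.inr ⟨w, hw, rfl⟩))
    have h4 := h2' w hw
    have := min_le_right e1 e2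
    linarith [h3.1]

theorem schmudgen_sum {n m a : ℕ} (g : Fin a → MvPolynomial (Fin n ⊕ Fin m) ℝ)
    (hK : IsCompact {w : (Fin n → ℝ) × (Fin m → ℝ) | ∀ j, 0 ≤ eval (Sum.elim w.1 w.2) (g j)})
    (f : MvPolynomial (Fin n ⊕ Fin m) ℝ)
    (hf : ∀ w : (Fin n → ℝ) × (Fin m → ℝ), (∀ j, 0 ≤ eval (Sum.elim w.1 w.2) (g j)) →
      0 < eval (Sum.elim w.1 w.2) f) : InPreordering g f := by
  have key : ∀ x : Fin n ⊕ Fin m → ℝ,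
      Sum.elim (fun i => x (Sum.inl i)) (fun i => x (Sum.inr i)) = x := by
    intro x; ext i; cases i <;> rfl
  refine schmudgen g ?_ f ?_
  · have hc : Continuous fun w : (Fin n → ℝ) × (Fin m → ℝ) => Sum.elim w.1 w.2 := by
      refine continuous_pi fun i => ?_
      cases i
      · exact (continuous_apply _).comp continuous_fst
      · exact (continuous_apply _).comp continuous_snd
    convert hK.image hc using 1
    ext x
    constructor
    · intro hx
      refine ⟨(fun i => x (Sum.inl i), fun i => x (Sum.inr i)), ?_, key x⟩
      intro j
      simp only [key]
      exact hx j
    · rintro ⟨w, hw, rfl⟩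
      exact hw
  · intro x hx
    have := hf (fun i => x (Sum.inl i), fun i => x (Sum.inr i)) (by
      intro j; simp only [key]; exact hx j)
    simpa only [key] using this

end Sep

theorem specialized_schmudgen_preordering
    (n m p a b : ℕ)
    (g : Fin a → MvPolynomial (Fin n ⊕ Fin m) ℝ)
    (h : Fin b → MvPolynomial (Fin m ⊕ Fin p) ℝ)
    (Kxy : Set ((Fin n → ℝ) × (Fin m → ℝ)))
    (Kyz : Set ((Fin m → ℝ) × (Fin p → ℝ)))
    (K : Set ((Fin n → ℝ) × (Fin m → ℝ) × (Fin p → ℝ)))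
    (hKxy : Kxy = {w | ∀ j, 0 ≤ eval (Sum.elim w.1 w.2) (g j)})
    (hKyz : Kyz = {w | ∀ k, 0 ≤ eval (Sum.elim w.1 w.2) (h k)})
    (hK : K = {w | (w.1, w.2.1) ∈ Kxy ∧ w.2 ∈ Kyz})
    (hKxyCompact : IsCompact Kxy) (hKyzCompact : IsCompact Kyz)
    (hKint : (interior K).Nonempty)
    (f : MvPolynomial (Fin n ⊕ Fin m ⊕ Fin p) ℝ)
    (f₁ : MvPolynomial (Fin n ⊕ Fin m) ℝ) (f₂ : MvPolynomial (Fin m ⊕ Fin p) ℝ)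
    (hf : f = rename (Sum.map id Sum.inl) f₁ + rename Sum.inr f₂)
    (hpos : ∀ w ∈ K, 0 < eval (Sum.elim w.1 (Sum.elim w.2.1 w.2.2)) f) :
    ∃ (σ : MvPolynomial (Fin n ⊕ Fin m) ℝ) (ψ : MvPolynomial (Fin m ⊕ Fin p) ℝ),
      InPreordering g σ ∧ InPreordering h ψ ∧
      f = rename (Sum.map id Sum.inl) σ + rename Sum.inr ψ := by
  have hcont : ∀ (k l : ℕ) (r : MvPolynomial (Fin k ⊕ Fin l) ℝ),
      Continuous fun w : (Fin k → ℝ) × (Fin l → ℝ) => eval (Sum.elim w.1 w.2) r := by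
    intro k l r
    refine (MvPolynomial.continuous_eval r).comp (continuous_pi fun i => ?_)
    cases i
    · exact (continuous_apply _).comp continuous_fst
    · exact (continuous_apply _).comp continuous_snd
  obtain ⟨q, hq1, hq2⟩ := sep_poly hKxyCompact hKyzCompact (hcont n m f₁) (hcont m p f₂) (by
    intro x y z hxy hyz
    have := hpos (x, y, z) (by rw [hK]; exact ⟨hxy, hyz⟩)
    rw [hf, map_add, eval_rename, eval_rename] at this
    have e1 : Sum.elim x (Sum.elim y z) ∘ Sum.map id Sum.inl = Sum.elim x y := by
      ext i; cases i <;> rfl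
    have e2 : Sum.elim x (Sum.elim y z) ∘ Sum.inr = Sum.elim y z := rfl
    simp only [e1, e2] at this
    exact this)
  refine ⟨f₁ - rename Sum.inr q, f₂ + rename Sum.inl q, ?_, ?_, ?_⟩
  · refine schmudgen_sum g (hKxy ▸ hKxyCompact) _ fun w hw => ?_
    have := hq1 w (by rw [hKxy]; exact hw)
    rw [map_sub, eval_rename, Sum.elim_comp_inr]
    linarith
  · refine schmudgen_sum h (hKyz ▸ hKyzCompact) _ fun w hw => ?_
    have := hq2 w (by rw [hKyz]; exact hw)
    rw [map_add, eval_rename, Sum.elim_comp_inl]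
    linarith
  · rw [hf, map_sub, map_add, rename_rename, rename_rename]
    have : (Sum.map id Sum.inl ∘ Sum.inr : Fin m → Fin n ⊕ Fin m ⊕ Fin p) = Sum.inr ∘ Sum.inl := rfl
    rw [this]
    ring
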